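/- Assume ERH. Let K be a quadratic number field whose discriminant D satisfies |D| > e^25. Then there exists a prime number p that splits in K with p ≤ (1.881·log|D| + 2·0.34 + 5.5)^2. -/

import Mathlib

open NumberField

/-- The extended Riemann hypothesis (for Dirichlet L-functions): no Dirichlet L-function
has a zero `s` with `1/2 < Re s < 1`. -/
def ERH : Prop :=
  ∀ (n : ℕ) [NeZero n] (χ : DirichletCharacter ℂ n) (s : ℂ),
    1 / 2 < s.re → s.re < 1 → DirichletCharacter.LFunction χ s ≠ 0

/-- A prime number `p` splits in the number field `K`:
`p O_K = 𝔭·𝔭′` for two distinct prime ideals of the ring of integers. -/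
def SplitsIn (p : ℕ) (K : Type) [Field K] [NumberField K] : Prop :=
  ∃ P Q : Ideal (𝓞 K), P ≠ Q ∧ P.IsPrime ∧ Q.IsPrime ∧
    Ideal.span {(p : 𝓞 K)} = P * Q

section

open MeasureTheory Set

/-- The `m`-th signed difference of `φ` at `s₀ + k`. -/
noncomputable def signedDiff (k m : ℕ) (s₀ : ℝ) (φ : ℝ → ℝ) : ℝ :=
  ∑ j ∈ Finset.range (m + 1), (-1) ^ j * (m.choose j : ℝ) * φ (s₀ + k + j)

theorem integrableOn_exp_mul_of_le {h : ℝ → ℝ} {s₀ s : ℝ} (hs : s₀ ≤ s)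
    (hh : IntegrableOn (fun t => Real.exp (-(s₀ * t)) * h t) (Ioi 0)) :
    IntegrableOn (fun t => Real.exp (-(s * t)) * h t) (Ioi 0) := by
  have e : (fun t => Real.exp (-(s * t)) * h t) =
      fun t => Real.exp (-((s - s₀) * t)) * (Real.exp (-(s₀ * t)) * h t) := by
    funext t
    rw [← mul_assoc, ← Real.exp_add]
    ring_nf
  rw [e]
  refine Integrable.bdd_mul (c := 1) hh (by fun_prop) ?_
  filter_upwards [ae_restrict_mem measurableSet_Ioi] with t ht
  have ht' : 0 < t := ht
  rw [Real.norm_eq_abs, abs_of_pos (Real.exp_pos _), Real.exp_le_one_iff]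
  nlinarith

theorem signedDiff_laplace {h : ℝ → ℝ} {s₀ : ℝ} (k m : ℕ)
    (hh : IntegrableOn (fun t => Real.exp (-(s₀ * t)) * h t) (Ioi 0)) :
    signedDiff k m s₀ (fun s => ∫ t in Ioi 0, Real.exp (-(s * t)) * h t) =
      ∫ t in Ioi 0, Real.exp (-t) ^ k * (1 - Real.exp (-t)) ^ m *
        (Real.exp (-(s₀ * t)) * h t) := by
  unfold signedDiff
  simp_rw [← integral_const_mul]
  rw [← integral_finsetSum]
  · congr 1
    funext t
    have e : (1 - Real.exp (-t)) ^ m = ∑ j ∈ Finset.range (m + 1),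
        (-1) ^ j * (m.choose j : ℝ) * Real.exp (-t) ^ j := by
      rw [sub_eq_neg_add, add_pow]
      refine Finset.sum_congr rfl fun j _ => ?_
      rw [neg_pow]
      ring
    rw [e, Finset.mul_sum, Finset.sum_mul]
    refine Finset.sum_congr rfl fun j _ => ?_
    have : Real.exp (-((s₀ + k + j) * t)) =
        Real.exp (-t) ^ k * Real.exp (-t) ^ j * Real.exp (-(s₀ * t)) := by
      rw [← Real.exp_nat_mul, ← Real.exp_nat_mul, ← Real.exp_add, ← Real.exp_add]
      ring_nf
    rw [this]
    ring
  · intro j _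
    refine Integrable.const_mul (integrableOn_exp_mul_of_le ?_ hh) _
    have : (0 : ℝ) ≤ k + j := by positivity
    linarith

theorem signedDiff_sub (k m : ℕ) (s₀ : ℝ) (φ ψ : ℝ → ℝ) :
    signedDiff k m s₀ (fun s => φ s - ψ s) = signedDiff k m s₀ φ - signedDiff k m s₀ ψ := by
  simp only [signedDiff, mul_sub, Finset.sum_sub_distrib]

theorem signedDiff_const_mul (k m : ℕ) (s₀ c : ℝ) (φ : ℝ → ℝ) :
    signedDiff k m s₀ (fun s => c * φ s) = c * signedDiff k m s₀ φ := by
  simp only [signedDiff, Finset.mul_sum]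
  exact Finset.sum_congr rfl fun j _ => by ring

theorem signedDiff_congr {k m : ℕ} {s₀ : ℝ} {φ ψ : ℝ → ℝ} (h : ∀ s, s₀ ≤ s → φ s = ψ s) :
    signedDiff k m s₀ φ = signedDiff k m s₀ ψ := by
  unfold signedDiff
  refine Finset.sum_congr rfl fun j _ => ?_
  rw [h]
  have : (0 : ℝ) ≤ k + j := by positivity
  linarith

/-- If all moments of `e^{-s₀ t} g(t)` against `e^{-kt} (1 - e^{-t})^m` are nonnegative then `g`
is nonnegative at its points of continuity. -/
theorem nonneg_of_moments_nonneg {g : ℝ → ℝ} {s₀ L : ℝ} (hL : 0 < L)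
    (hg : IntegrableOn (fun t => Real.exp (-(s₀ * t)) * g t) (Ioi 0)) (hc : ContinuousAt g L)
    (hm : ∀ k m : ℕ, 0 ≤ ∫ t in Ioi 0, Real.exp (-t) ^ k * (1 - Real.exp (-t)) ^ m *
        (Real.exp (-(s₀ * t)) * g t)) : 0 ≤ g L := by
  set w : ℝ → ℝ := fun t => Real.exp (-(s₀ * t)) * g t with hw
  let J : ℝ → unitInterval := fun t => Set.projIcc 0 1 zero_le_one (Real.exp (-t))
  have hJ : Continuous J := continuous_projIcc.comp (by fun_prop)
  have hJv : ∀ t ∈ Ioi (0 : ℝ), (J t : ℝ) = Real.exp (-t) := by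
    intro t ht
    have ht' : 0 < t := ht
    simp only [J]
    rw [Set.projIcc_of_mem zero_le_one ⟨(Real.exp_pos _).le, Real.exp_le_one_iff.2 (by linarith)⟩]
  have hInt : ∀ φ : C(unitInterval, ℝ), IntegrableOn (fun t => φ (J t) * w t) (Ioi 0) := by
    intro φ
    refine Integrable.bdd_mul (c := ‖φ‖) hg (φ.continuous.comp hJ).aestronglyMeasurable ?_
    exact Filter.Eventually.of_forall fun t => φ.norm_coe_le_norm _
  -- nonnegative functionals on Bernstein polynomials
  have hB : ∀ φ : C(unitInterval, ℝ), (∀ u, 0 ≤ φ u) → ∀ n,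
      0 ≤ ∫ t in Ioi 0, bernsteinApproximation n φ (J t) * w t := by
    intro φ hφ n
    simp only [bernsteinApproximation, ContinuousMap.coe_sum, Finset.sum_apply, Finset.sum_mul]
    rw [integral_finsetSum]
    · refine Finset.sum_nonneg fun k _ => ?_
      have e : ∫ t in Ioi 0, (bernstein n k • ContinuousMap.const unitInterval
            (φ (bernstein.z k))) (J t) * w t =
          ∫ t in Ioi 0, (φ (bernstein.z k) * (n.choose k : ℝ)) *
            (Real.exp (-t) ^ (k : ℕ) * (1 - Real.exp (-t)) ^ (n - k : ℕ) * w t) := by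
        refine setIntegral_congr_fun measurableSet_Ioi fun t ht => ?_
        simp [bernstein_apply, hJv t ht]
        ring
      rw [e, integral_const_mul]
      exact mul_nonneg (mul_nonneg (hφ _) (by positivity)) (hm _ _)
    · intro k _
      exact hInt (bernstein n k • ContinuousMap.const unitInterval (φ (bernstein.z k)))
  have hP : ∀ φ : C(unitInterval, ℝ), (∀ u, 0 ≤ φ u) → 0 ≤ ∫ t in Ioi 0, φ (J t) * w t := by
    intro φ hφ
    have hlim : Filter.Tendsto (fun n => ∫ t in Ioi 0, bernsteinApproximation n φ (J t) * w t)
        Filter.atTop (nhds (∫ t in Ioi 0, φ (J t) * w t)) := by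
      rw [tendsto_iff_norm_sub_tendsto_zero]
      have h1 : Filter.Tendsto (fun n => ‖bernsteinApproximation n φ - φ‖ *
          ∫ t in Ioi 0, ‖w t‖) Filter.atTop (nhds 0) := by
        have := (tendsto_iff_norm_sub_tendsto_zero.1 (bernsteinApproximation_uniform φ)).mul_const
          (∫ t in Ioi 0, ‖w t‖)
        simpa using this
      refine squeeze_zero (fun n => norm_nonneg _) (fun n => ?_) h1
      rw [← integral_sub (hInt _) (hInt _), ← integral_const_mul]
      refine norm_integral_le_of_norm_le (hg.norm.const_mul _) ?_
      refine Filter.Eventually.of_forall fun t => ?_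
      rw [← sub_mul, norm_mul]
      exact mul_le_mul_of_nonneg_right
        ((bernsteinApproximation n φ - φ).norm_coe_le_norm (J t)) (norm_nonneg _)
    exact ge_of_tendsto' hlim fun n => hB φ hφ n
  by_contra hneg
  push Not at hneg
  obtain ⟨δ, hδ, hδg⟩ := Metric.eventually_nhds_iff.1
    (hc.eventually (gt_mem_nhds hneg))
  -- choose a tent function around `e^{-L}`
  have hlog : ContinuousAt (fun u => -Real.log u) (Real.exp (-L)) :=
    (Real.continuousAt_log (Real.exp_pos _).ne').neg
  obtain ⟨ε, hε, hεg⟩ := Metric.continuousAt_iff.1 hlog δ hδ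
  let φ : C(unitInterval, ℝ) :=
    ⟨fun u => max 0 (ε - |(u : ℝ) - Real.exp (-L)|), by fun_prop⟩
  have hneg' : ∀ t ∈ Ioi (0 : ℝ), φ (J t) * w t ≤ 0 := by
    intro t ht
    by_cases hh : |Real.exp (-t) - Real.exp (-L)| < ε
    · have := hεg (x := Real.exp (-t)) (by rwa [Real.dist_eq])
      simp only [Real.log_exp, neg_neg] at this
      have h2 : g t < 0 := hδg this
      refine mul_nonpos_of_nonneg_of_nonpos (le_max_left _ _) ?_
      exact mul_nonpos_of_nonneg_of_nonpos (Real.exp_pos _).le h2.le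
    · have : φ (J t) = 0 := by
        simp only [φ, ContinuousMap.coe_mk, hJv t ht]
        exact max_eq_left (by linarith)
      rw [this, zero_mul]
  have h0 : ∫ t in Ioi 0, φ (J t) * w t = 0 :=
    le_antisymm (setIntegral_nonpos measurableSet_Ioi hneg') (hP φ fun u => le_max_left _ _)
  have hae : (fun t => -(φ (J t) * w t)) =ᵐ[volume.restrict (Ioi 0)] 0 := by
    rw [← integral_eq_zero_iff_of_nonneg_ae, integral_neg, h0, neg_zero]
    · filter_upwards [ae_restrict_mem measurableSet_Ioi] with t ht
      simpa using hneg' t ht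
    · exact (hInt φ).neg
  have hev : ∀ᶠ t in nhds L, 0 < t ∧ |Real.exp (-t) - Real.exp (-L)| < ε := by
    refine (lt_mem_nhds hL).and ?_
    have : ContinuousAt (fun t => Real.exp (-t)) L := by fun_prop
    have := Metric.tendsto_nhds.1 this ε hε
    simpa [Real.dist_eq] using this
  obtain ⟨η, hη, hηg⟩ := Metric.eventually_nhds_iff.1 hev
  rw [Filter.EventuallyEq, ae_restrict_iff' measurableSet_Ioi] at hae
  have hz : volume (Metric.ball L η) = 0 := by
    refine measure_mono_null ?_ hae
    intro t ht hcon
    obtain ⟨h1, h2⟩ := hηg (Metric.mem_ball.1 ht)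
    have h3 := hcon h1
    have := hεg (x := Real.exp (-t)) (by rwa [Real.dist_eq])
    simp only [Real.log_exp, neg_neg] at this
    have h4 : g t < 0 := hδg this
    have h5 : 0 < φ (J t) := by
      simp only [φ, ContinuousMap.coe_mk, hJv t h1]
      exact lt_max_of_lt_right (by linarith)
    have h6 : w t < 0 := mul_neg_of_pos_of_neg (Real.exp_pos _) h4
    have h7 := mul_neg_of_pos_of_neg h5 h6
    simp only [Pi.zero_apply] at h3
    linarith
  exact (Metric.measure_ball_pos volume L hη).ne' hz

end

section

open MeasureTheory Set

theorem integrableOn_exp_neg_mul {s : ℝ} (hs : 0 < s) :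
    IntegrableOn (fun t : ℝ => Real.exp (-(s * t))) (Ioi 0) := by
  simpa using exp_neg_integrableOn_Ioi 0 hs

theorem integral_exp_neg_mul {s : ℝ} (hs : 0 < s) :
    ∫ t in Ioi 0, Real.exp (-(s * t)) = 1 / s := by
  have := Real.integral_rpow_mul_exp_neg_mul_Ioi (a := 1) one_pos hs
  simpa using this

theorem integrableOn_mul_exp_neg_mul {s : ℝ} (hs : 0 < s) :
    IntegrableOn (fun t : ℝ => t * Real.exp (-(s * t))) (Ioi 0) := by
  have := integrableOn_rpow_mul_exp_neg_mul_rpow (p := 1) (s := 1) (by norm_num) one_pos hs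
  simpa using this

theorem integral_mul_exp_neg_mul {s : ℝ} (hs : 0 < s) :
    ∫ t in Ioi 0, t * Real.exp (-(s * t)) = 1 / s ^ 2 := by
  have := Real.integral_rpow_mul_exp_neg_mul_Ioi (a := 2) two_pos hs
  norm_num at this
  rw [← setIntegral_congr_fun (g := fun t : ℝ => t * Real.exp (-(s * t))) measurableSet_Ioi
    (fun t _ => rfl), this]
  norm_num

/-- The dominating function for the Laplace originals of the Herglotz kernels. -/
noncomputable def herglotzMajorant (t : ℝ) : ℝ := 1 + (1 + t) * Real.exp (-t)

theorem continuous_herglotzMajorant : Continuous herglotzMajorant := by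
  unfold herglotzMajorant; fun_prop

theorem integrableOn_herglotzMajorant {s : ℝ} (hs : 0 < s) :
    IntegrableOn (fun t => Real.exp (-(s * t)) * herglotzMajorant t) (Ioi 0) := by
  have e : (fun t => Real.exp (-(s * t)) * herglotzMajorant t) = fun t =>
      Real.exp (-(s * t)) + (Real.exp (-((s + 1) * t)) + t * Real.exp (-((s + 1) * t))) := by
    funext t
    have : Real.exp (-((s + 1) * t)) = Real.exp (-(s * t)) * Real.exp (-t) := by
      rw [← Real.exp_add]; ring_nf
    rw [this, herglotzMajorant]; ring
  rw [e]
  exact (integrableOn_exp_neg_mul hs).add ((integrableOn_exp_neg_mul (by linarith)).add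
    (integrableOn_mul_exp_neg_mul (by linarith)))

/-- The Laplace original of `s ↦ Re ((ω + z) / (ω - z)) / (1 + s)²`, `z = (1 - s) / (1 + s)`. -/
theorem exists_herglotz_original {ω : ℂ} (hω : ‖ω‖ = 1) :
    ∃ A : ℝ → ℝ, Continuous A ∧ (∀ t, 0 < t → |A t| ≤ herglotzMajorant t) ∧
      ∀ s : ℝ, 0 < s → ∫ t in Ioi 0, Real.exp (-(s * t)) * A t =
        ((ω + ((1 - s) / (1 + s) : ℝ)) / (ω - ((1 - s) / (1 + s) : ℝ))).re / (1 + s) ^ 2 := by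
  by_cases h1 : ω = -1
  · subst h1
    refine ⟨fun t => Real.exp (-t) - t * Real.exp (-t), by fun_prop, ?_, ?_⟩
    · intro t ht
      rw [abs_le, herglotzMajorant]
      have := Real.exp_pos (-t)
      have : Real.exp (-t) ≤ 1 := Real.exp_le_one_iff.2 (by linarith)
      constructor <;> nlinarith
    · intro s hs
      have e : (fun t => Real.exp (-(s * t)) * (Real.exp (-t) - t * Real.exp (-t))) = fun t =>
          Real.exp (-((s + 1) * t)) - t * Real.exp (-((s + 1) * t)) := by
        funext t
        have : Real.exp (-((s + 1) * t)) = Real.exp (-(s * t)) * Real.exp (-t) := by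
          rw [← Real.exp_add]; ring_nf
        rw [this]; ring
      rw [e, integral_sub (integrableOn_exp_neg_mul (by linarith))
        (integrableOn_mul_exp_neg_mul (by linarith)), integral_exp_neg_mul (by linarith),
        integral_mul_exp_neg_mul (by linarith)]
      have e2 : ((-1 : ℂ) + ((1 - s) / (1 + s) : ℝ)) / (-1 - ((1 - s) / (1 + s) : ℝ)) =
          ((-1 + (1 - s) / (1 + s)) / (-1 - (1 - s) / (1 + s)) : ℝ) := by push_cast; rfl
      rw [e2, Complex.ofReal_re]
      have : 1 + s ≠ 0 := by positivity
      have h3 : (-1 - (1 - s) / (1 + s)) = -2 / (1 + s) := by field_simp; ring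
      rw [h3]
      field_simp
      ring
  · set β : ℂ := (1 - ω) / (1 + ω) with hβ
    have h2 : 1 + ω ≠ 0 := fun h => h1 (by linear_combination h)
    have hns : ω.re * ω.re + ω.im * ω.im = 1 := by
      have := Complex.normSq_eq_norm_sq ω
      rw [hω, Complex.normSq_apply] at this
      linarith
    have hβre : β.re = 0 := by
      rw [hβ, Complex.div_re, ← add_div]
      simp only [Complex.sub_re, Complex.one_re, Complex.add_re, Complex.sub_im, Complex.one_im,
        Complex.add_im]
      rw [div_eq_zero_iff]
      left
      linarith
    have hnb : ∀ t : ℝ, ‖Complex.exp (β * t)‖ = 1 := by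
      intro t
      simp [Complex.norm_exp, hβre]
    refine ⟨fun t => (ω * Complex.exp (β * t) - ω * Real.exp (-t) - t * Real.exp (-t)).re,
      by fun_prop, ?_, ?_⟩
    · intro t ht
      refine (Complex.abs_re_le_norm _).trans ?_
      refine (norm_sub_le _ _).trans ?_
      have h3 := norm_sub_le (ω * Complex.exp (β * t)) (ω * Real.exp (-t))
      rw [norm_mul, norm_mul, hω, hnb, Complex.norm_real, Real.norm_eq_abs,
        abs_of_pos (Real.exp_pos _)] at h3
      rw [norm_mul, Complex.norm_real, Complex.norm_real, Real.norm_eq_abs, Real.norm_eq_abs,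
        abs_of_pos (Real.exp_pos _), abs_of_pos ht, herglotzMajorant]
      linarith
    · intro s hs
      have hsβ : (β - s).re < 0 := by simp [hβre, hs]
      have i1 := integrableOn_exp_mul_complex_Ioi hsβ 0
      have i2 : IntegrableOn (fun t : ℝ => ((Real.exp (-((s + 1) * t)) : ℝ) : ℂ)) (Ioi 0) :=
        (integrableOn_exp_neg_mul (by linarith)).ofReal
      have i3 : IntegrableOn (fun t : ℝ => ((t * Real.exp (-((s + 1) * t)) : ℝ) : ℂ)) (Ioi 0) :=
        (integrableOn_mul_exp_neg_mul (by linarith)).ofReal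
      have e : (fun t : ℝ => Real.exp (-(s * t)) *
          (ω * Complex.exp (β * t) - ω * Real.exp (-t) - t * Real.exp (-t)).re) = fun t : ℝ =>
          RCLike.re (ω * Complex.exp ((β - s) * t) - ω * ((Real.exp (-((s + 1) * t)) : ℝ) : ℂ) -
            ((t * Real.exp (-((s + 1) * t)) : ℝ) : ℂ)) := by
        funext t
        rw [← Complex.re_ofReal_mul]
        have e1 : Complex.exp ((β - s) * t) = (Real.exp (-(s * t)) : ℝ) * Complex.exp (β * t) := by
          push_cast
          rw [← Complex.exp_add]; ring_nf
        have e2 : Real.exp (-((s + 1) * t)) = Real.exp (-(s * t)) * Real.exp (-t) := by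
          rw [← Real.exp_add]; ring_nf
        rw [e1, e2]
        simp only [RCLike.re_eq_complex_re]
        push_cast
        ring_nf
      have i12 : IntegrableOn (fun t : ℝ => ω * Complex.exp ((β - s) * t) -
          ω * ((Real.exp (-((s + 1) * t)) : ℝ) : ℂ)) (Ioi 0) :=
        (i1.const_mul ω).sub (i2.const_mul ω)
      have i123 : IntegrableOn (fun t : ℝ => ω * Complex.exp ((β - s) * t) -
          ω * ((Real.exp (-((s + 1) * t)) : ℝ) : ℂ) -
          ((t * Real.exp (-((s + 1) * t)) : ℝ) : ℂ)) (Ioi 0) := i12.sub i3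
      rw [e, integral_re i123]
      rw [integral_sub i12 i3, integral_sub (i1.const_mul ω) (i2.const_mul ω),
        integral_const_mul, integral_const_mul, integral_exp_mul_complex_Ioi hsβ,
        integral_complex_ofReal, integral_complex_ofReal, integral_exp_neg_mul (by linarith),
        integral_mul_exp_neg_mul (by linarith)]
      rw [RCLike.re_eq_complex_re, ← Complex.div_ofReal_re]
      congr 1
      have h3 : (1 + s : ℂ) ≠ 0 := by exact_mod_cast (by positivity : 1 + s ≠ 0)
      have h4 : β - s ≠ 0 := fun h => by rw [h] at hsβ; simp at hsβ
      have h4' : (s : ℂ) * (1 + ω) - (1 - ω) ≠ 0 := by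
        intro h
        apply h4
        rw [hβ]
        field_simp
        linear_combination -h
      have h5 : ω - ((1 - s) / (1 + s) : ℝ) = ((s : ℂ) * (1 + ω) - (1 - ω)) / (1 + s) := by
        push_cast
        field_simp
        ring
      have h5' : ω + ((1 - s) / (1 + s) : ℝ) = ((1 + ω) - s * (1 - ω)) / (1 + s) := by
        push_cast
        field_simp
        ring
      have h6 : β - s = -((s : ℂ) * (1 + ω) - (1 - ω)) / (1 + ω) := by
        rw [hβ]; field_simp; ring
      rw [h5, h5', h6]
      push_cast
      have h7 : (s + 1 : ℂ) ≠ 0 := by rwa [add_comm]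
      simp only [mul_zero, Complex.exp_zero]
      field_simp
      ring

theorem signedDiff_herglotz_le {ω : ℂ} (hω : ‖ω‖ = 1) (k m : ℕ) {s₀ : ℝ} (hs₀ : 0 < s₀) :
    |signedDiff k m s₀ (fun s =>
        ((ω + ((1 - s) / (1 + s) : ℝ)) / (ω - ((1 - s) / (1 + s) : ℝ))).re / (1 + s) ^ 2)| ≤
      signedDiff k m s₀
        (fun s => ∫ t in Ioi 0, Real.exp (-(s * t)) * herglotzMajorant t) := by
  obtain ⟨A, hAc, hAb, hA⟩ := exists_herglotz_original hω
  have hM := integrableOn_herglotzMajorant hs₀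
  have hAi : IntegrableOn (fun t => Real.exp (-(s₀ * t)) * A t) (Ioi 0) := by
    refine Integrable.mono' hM (by fun_prop) ?_
    filter_upwards [ae_restrict_mem measurableSet_Ioi] with t ht
    rw [norm_mul, Real.norm_eq_abs, abs_of_pos (Real.exp_pos _)]
    exact mul_le_mul_of_nonneg_left (hAb t ht) (Real.exp_pos _).le
  have hw : ∀ t ∈ Ioi (0 : ℝ), 0 ≤ Real.exp (-t) ^ k * (1 - Real.exp (-t)) ^ m ∧
      Real.exp (-t) ^ k * (1 - Real.exp (-t)) ^ m ≤ 1 := by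
    intro t ht
    have ht' : 0 < t := ht
    have h1 : Real.exp (-t) ≤ 1 := Real.exp_le_one_iff.2 (by linarith)
    have h2 := Real.exp_pos (-t)
    refine ⟨mul_nonneg (by positivity) (pow_nonneg (by linarith) _), ?_⟩
    exact mul_le_one₀ (pow_le_one₀ h2.le h1) (pow_nonneg (by linarith) _)
      (pow_le_one₀ (by linarith) (by linarith))
  rw [signedDiff_congr (ψ := fun s => ∫ t in Ioi 0, Real.exp (-(s * t)) * A t)
    fun s hs => (hA s (by linarith)).symm, signedDiff_laplace k m hAi, signedDiff_laplace k m hM]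
  rw [← Real.norm_eq_abs]
  refine norm_integral_le_of_norm_le ?_ ?_
  · refine Integrable.bdd_mul (c := 1) hM (by fun_prop) ?_
    filter_upwards [ae_restrict_mem measurableSet_Ioi] with t ht
    rw [Real.norm_eq_abs, abs_of_nonneg (hw t ht).1]
    exact (hw t ht).2
  · filter_upwards [ae_restrict_mem measurableSet_Ioi] with t ht
    rw [norm_mul, Real.norm_eq_abs, abs_of_nonneg (hw t ht).1, norm_mul, Real.norm_eq_abs,
      abs_of_pos (Real.exp_pos _)]
    exact mul_le_mul_of_nonneg_left
      (mul_le_mul_of_nonneg_left (hAb t ht) (Real.exp_pos _).le) (hw t ht).1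

end

section

open MeasureTheory Set

theorem re_cayley_pos {z : ℂ} (hz : ‖z‖ < 1) : 0 < ((1 - z) / (1 + z)).re := by
  have hns : z.re * z.re + z.im * z.im < 1 := by
    have := Complex.normSq_eq_norm_sq z
    rw [Complex.normSq_apply] at this
    nlinarith [norm_nonneg z]
  have h1 : 1 + z ≠ 0 := by
    intro h
    have : z = -1 := by linear_combination h
    simp [this] at hz
  rw [Complex.div_re, ← add_div]
  refine div_pos ?_ (Complex.normSq_pos.2 h1)
  simp
  nlinarith

theorem signedDiff_re_le_of_radius {F : ℂ → ℂ} (hF : DifferentiableOn ℂ F {w | 0 < w.re})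
    (hpos : ∀ w : ℂ, 0 < w.re → 0 ≤ (F w).re) (k m : ℕ) {s₀ : ℝ} (hs₀ : 0 < s₀) {r : ℝ}
    (hr0 : 0 < r) (hr1 : r < 1) :
    |signedDiff k m s₀ (fun s => (F ((1 - r * ((1 - s) / (1 + s) : ℝ)) /
        (1 + r * ((1 - s) / (1 + s) : ℝ)))).re / (1 + s) ^ 2)| ≤
      (F 1).re * signedDiff k m s₀
        (fun s => ∫ t in Ioi 0, Real.exp (-(s * t)) * herglotzMajorant t) := by
  set B := signedDiff k m s₀
        (fun s => ∫ t in Ioi 0, Real.exp (-(s * t)) * herglotzMajorant t) with hB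
  set f : ℂ → ℂ := fun z => F ((1 - z) / (1 + z)) with hf
  have hne : ∀ z : ℂ, ‖z‖ < 1 → 1 + z ≠ 0 := by
    intro z hz h
    have : z = -1 := by linear_combination h
    simp [this] at hz
  have hfd : DifferentiableOn ℂ f (Metric.ball 0 1) := by
    refine hF.comp ?_ fun z hz => re_cayley_pos (by simpa using hz)
    refine DifferentiableOn.div (by fun_prop) (by fun_prop) fun z hz => hne z (by simpa using hz)
  have hfr : DiffContOnCl ℂ f (Metric.ball 0 r) :=
    (hfd.mono (Metric.closedBall_subset_ball hr1)).diffContOnCl_ball subset_rfl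
  have hcm : ∀ θ, circleMap 0 r θ ∈ Metric.ball (0 : ℂ) 1 := by
    intro θ
    simp [abs_of_pos hr0, hr1]
  have hfc : Continuous fun θ : ℝ => (f (circleMap 0 r θ)).re :=
    Complex.continuous_re.comp (hfd.continuousOn.comp_continuous (continuous_circleMap 0 r) hcm)
  have hz : ∀ s : ℝ, 0 < s → |(1 - s) / (1 + s)| < 1 := by
    intro s hs
    rw [abs_lt]
    constructor
    · rw [lt_div_iff₀ (by linarith)]; linarith
    · rw [div_lt_iff₀ (by linarith)]; linarith
  -- the kernel on the unit circle
  let K : ℝ → ℝ → ℝ := fun s θ => ((circleMap 0 1 θ + ((1 - s) / (1 + s) : ℝ)) /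
    (circleMap 0 1 θ - ((1 - s) / (1 + s) : ℝ))).re
  have hcm1 : ∀ θ, ‖circleMap 0 1 θ‖ = 1 := by intro θ; simp
  have hKc : ∀ s, 0 < s → Continuous (K s) := by
    intro s hs
    refine Complex.continuous_re.comp (Continuous.div ?_ ?_ ?_)
    · exact (continuous_circleMap 0 1).add continuous_const
    · exact (continuous_circleMap 0 1).sub continuous_const
    · intro θ h
      have := hz s hs
      rw [sub_eq_zero] at h
      have h2 := hcm1 θ
      rw [h, Complex.norm_real, Real.norm_eq_abs] at h2
      linarith
  have hpoisson : ∀ s : ℝ, 0 < s → (f (r * ((1 - s) / (1 + s) : ℝ))).re =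
      (2 * Real.pi)⁻¹ * ∫ θ in (0 : ℝ)..2 * Real.pi, K s θ * (f (circleMap 0 r θ)).re := by
    intro s hs
    have hw : (r * ((1 - s) / (1 + s) : ℝ) : ℂ) ∈ Metric.ball (0 : ℂ) r := by
      rw [mem_ball_zero_iff, norm_mul, Complex.norm_real, Complex.norm_real, Real.norm_eq_abs,
        Real.norm_eq_abs, abs_of_pos hr0]
      nlinarith [hz s hs]
    have h1 := InnerProductSpace.HarmonicContOnCl.circleAverage_re_herglotzRieszKernel_smul
      (f := fun z => (f z).re) (c := 0) (R := r) ?_ hw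
    · rw [← h1, Real.circleAverage_def, smul_eq_mul]
      congr 1
      refine intervalIntegral.integral_congr fun θ _ => ?_
      simp only [Pi.smul_apply', Function.comp_apply, herglotzRieszKernel_def, smul_eq_mul]
      congr 2
      have : circleMap 0 r θ = r * circleMap 0 1 θ := by simp [circleMap]
      rw [this]
      have hr : (r : ℂ) ≠ 0 := by exact_mod_cast hr0.ne'
      simp only [sub_zero]
      rw [← mul_add, ← mul_sub, mul_div_mul_left _ _ hr]
    · refine ⟨?_, ?_⟩
      · intro z hz
        have : AnalyticAt ℂ f z := hfd.analyticAt
          (Metric.isOpen_ball.mem_nhds (Metric.ball_subset_ball hr1.le hz))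
        exact this.harmonicAt_re
      · exact Complex.continuous_re.comp_continuousOn hfr.continuousOn
  have h0 : (F 1).re = (2 * Real.pi)⁻¹ * ∫ θ in (0 : ℝ)..2 * Real.pi,
      (f (circleMap 0 r θ)).re := by
    have := hpoisson 1 one_pos
    have e : ∀ θ, K 1 θ = 1 := by
      intro θ
      have : circleMap 0 1 θ ≠ 0 := by
        intro h; have := hcm1 θ; rw [h] at this; simp at this
      simp [K, this]
    simp only [e, one_mul] at this
    rw [← this]
    simp [hf]
  have hInt : ∀ j : ℕ, IntervalIntegrable (fun θ => (-1) ^ j * (m.choose j : ℝ) *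
      (K (s₀ + k + j) θ / (1 + (s₀ + k + j)) ^ 2 * (f (circleMap 0 r θ)).re)) volume 0
      (2 * Real.pi) := by
    intro j
    refine Continuous.intervalIntegrable ?_ _ _
    have := hKc (s₀ + k + j) (by positivity)
    fun_prop
  have hmain : signedDiff k m s₀ (fun s => (f (r * ((1 - s) / (1 + s) : ℝ))).re / (1 + s) ^ 2) =
      (2 * Real.pi)⁻¹ * ∫ θ in (0 : ℝ)..2 * Real.pi,
        signedDiff k m s₀ (fun s => K s θ / (1 + s) ^ 2) * (f (circleMap 0 r θ)).re := by
    rw [signedDiff_congr (ψ := fun s => ((2 * Real.pi)⁻¹ * ∫ θ in (0 : ℝ)..2 * Real.pi,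
      K s θ * (f (circleMap 0 r θ)).re) / (1 + s) ^ 2)
      fun s hs => by rw [hpoisson s (by linarith)]]
    unfold signedDiff
    have e : ∀ θ, (∑ j ∈ Finset.range (m + 1), (-1) ^ j * (m.choose j : ℝ) *
        (K (s₀ + k + j) θ / (1 + (s₀ + k + j)) ^ 2)) * (f (circleMap 0 r θ)).re =
        ∑ j ∈ Finset.range (m + 1), (-1) ^ j * (m.choose j : ℝ) *
        (K (s₀ + k + j) θ / (1 + (s₀ + k + j)) ^ 2 * (f (circleMap 0 r θ)).re) := by
      intro θ
      rw [Finset.sum_mul]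
      exact Finset.sum_congr rfl fun j _ => by ring
    simp_rw [e]
    rw [intervalIntegral.integral_finsetSum fun j _ => hInt j, Finset.mul_sum]
    refine Finset.sum_congr rfl fun j _ => ?_
    rw [intervalIntegral.integral_const_mul]
    have e2 : (fun θ => K (s₀ + k + j) θ / (1 + (s₀ + k + j)) ^ 2 * (f (circleMap 0 r θ)).re) =
        fun θ => (1 / (1 + (s₀ + k + j)) ^ 2) *
          (K (s₀ + k + j) θ * (f (circleMap 0 r θ)).re) := by
      funext θ; ring
    rw [e2, intervalIntegral.integral_const_mul]
    ring
  have hgoal : signedDiff k m s₀ (fun s => (F ((1 - r * ((1 - s) / (1 + s) : ℝ)) /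
        (1 + r * ((1 - s) / (1 + s) : ℝ)))).re / (1 + s) ^ 2) =
        signedDiff k m s₀ (fun s => (f (r * ((1 - s) / (1 + s) : ℝ))).re / (1 + s) ^ 2) := rfl
  rw [hgoal, hmain, h0, abs_mul, abs_of_pos (by positivity), mul_assoc]
  refine mul_le_mul_of_nonneg_left ?_ (by positivity)
  rw [← intervalIntegral.integral_mul_const]
  have hi : IntervalIntegrable (fun θ => (f (circleMap 0 r θ)).re * B) volume 0 (2 * Real.pi) :=
    (hfc.mul continuous_const).intervalIntegrable _ _
  rw [← Real.norm_eq_abs]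
  refine intervalIntegral.norm_integral_le_of_norm_le (by positivity) ?_ hi
  refine Filter.Eventually.of_forall fun θ _ => ?_
  have hfp : 0 ≤ (f (circleMap 0 r θ)).re :=
    hpos _ (re_cayley_pos (by simpa using hcm θ))
  rw [norm_mul, Real.norm_eq_abs, Real.norm_eq_abs, abs_of_nonneg hfp, mul_comm]
  exact mul_le_mul_of_nonneg_left (signedDiff_herglotz_le (hcm1 θ) k m hs₀) hfp

/-- A function with nonnegative real part on the right half plane has controlled signed
differences. -/
theorem signedDiff_re_le {F : ℂ → ℂ} (hF : DifferentiableOn ℂ F {w | 0 < w.re})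
    (hpos : ∀ w : ℂ, 0 < w.re → 0 ≤ (F w).re) (k m : ℕ) {s₀ : ℝ} (hs₀ : 0 < s₀) :
    |signedDiff k m s₀ (fun s => (F s).re / (1 + s) ^ 2)| ≤
      (F 1).re * signedDiff k m s₀
        (fun s => ∫ t in Ioi 0, Real.exp (-(s * t)) * herglotzMajorant t) := by
  have hlim : Filter.Tendsto (fun r : ℝ => |signedDiff k m s₀ (fun s =>
      (F ((1 - r * ((1 - s) / (1 + s) : ℝ)) / (1 + r * ((1 - s) / (1 + s) : ℝ)))).re /
        (1 + s) ^ 2)|) (nhdsWithin 1 (Iio 1))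
      (nhds |signedDiff k m s₀ (fun s => (F s).re / (1 + s) ^ 2)|) := by
    refine (Filter.Tendsto.abs ?_)
    unfold signedDiff
    refine tendsto_finsetSum _ fun j _ => Filter.Tendsto.const_mul _ (Filter.Tendsto.div_const ?_ _)
    set s := s₀ + k + j with hs
    have hsp : 0 < s := by positivity
    have h1 : (1 + s : ℂ) ≠ 0 := by exact_mod_cast (by positivity : 1 + s ≠ 0)
    have h3 : (1 + (1 : ℝ) * ((1 - s) / (1 + s) : ℝ) : ℂ) ≠ 0 := by
      have : (1 + (1 : ℝ) * ((1 - s) / (1 + s) : ℝ) : ℂ) = 2 / (1 + s) := by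
        push_cast; field_simp; ring
      rw [this]
      exact div_ne_zero two_ne_zero h1
    have h2 : (1 - (1 : ℝ) * ((1 - s) / (1 + s) : ℝ) : ℂ) /
        (1 + (1 : ℝ) * ((1 - s) / (1 + s) : ℝ)) = s := by
      push_cast at h3 ⊢
      rw [div_eq_iff h3]
      field_simp
      ring
    have hFc : ContinuousAt F s :=
      (hF.differentiableAt ((isOpen_lt continuous_const Complex.continuous_re).mem_nhds
        (by simpa using hsp))).continuousAt
    have hc : ContinuousAt (fun r : ℝ => (1 - r * ((1 - s) / (1 + s) : ℝ) : ℂ) /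
        (1 + r * ((1 - s) / (1 + s) : ℝ))) 1 :=
      ContinuousAt.div (by fun_prop) (by fun_prop) h3
    have : ContinuousAt (fun r : ℝ => (F ((1 - r * ((1 - s) / (1 + s) : ℝ) : ℂ) /
        (1 + r * ((1 - s) / (1 + s) : ℝ)))).re) 1 :=
      Complex.continuous_re.continuousAt.comp
        (ContinuousAt.comp (f := fun r : ℝ => (1 - r * ((1 - s) / (1 + s) : ℝ) : ℂ) /
        (1 + r * ((1 - s) / (1 + s) : ℝ))) (g := F) (by rw [h2]; exact hFc) hc)
    have h4 := this.tendsto.mono_left (nhdsWithin_le_nhds (s := Iio 1))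
    rwa [h2] at h4
  refine le_of_tendsto hlim ?_
  filter_upwards [Ioo_mem_nhdsLT (zero_lt_one (α := ℝ))] with r hr
  exact signedDiff_re_le_of_radius hF hpos k m hs₀ hr.1 hr.2

/-- If `a` has Laplace transform `(F - H) / (1 + s)²` with `F`, `H` of nonnegative real part on the
right half plane, then `a` is bounded by `(F(1) + H(1)) (1 + (1 + L) e^{-L})`. -/
theorem le_of_laplace_eq {F H : ℂ → ℂ} (hF : DifferentiableOn ℂ F {w | 0 < w.re})
    (hFpos : ∀ w : ℂ, 0 < w.re → 0 ≤ (F w).re) (hH : DifferentiableOn ℂ H {w | 0 < w.re})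
    (hHpos : ∀ w : ℂ, 0 < w.re → 0 ≤ (H w).re) {a : ℝ → ℝ} {s₀ L : ℝ} (hs₀ : 0 < s₀) (hL : 0 < L)
    (hai : IntegrableOn (fun t => Real.exp (-(s₀ * t)) * a t) (Ioi 0)) (hac : ContinuousAt a L)
    (ha : ∀ s, s₀ ≤ s → ∫ t in Ioi 0, Real.exp (-(s * t)) * a t =
      ((F s).re - (H s).re) / (1 + s) ^ 2) :
    a L ≤ ((F 1).re + (H 1).re) * (1 + (1 + L) * Real.exp (-L)) := by
  have hM := integrableOn_herglotzMajorant hs₀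
  set C := (F 1).re + (H 1).re with hC
  have hCM : IntegrableOn (fun t => C * (Real.exp (-(s₀ * t)) * herglotzMajorant t)) (Ioi 0) :=
    hM.const_mul C
  have e : (fun t => Real.exp (-(s₀ * t)) * (C * herglotzMajorant t - a t)) =
      fun t => C * (Real.exp (-(s₀ * t)) * herglotzMajorant t) - Real.exp (-(s₀ * t)) * a t := by
    funext t; ring
  have hgi : IntegrableOn (fun t => Real.exp (-(s₀ * t)) * (C * herglotzMajorant t - a t))
      (Ioi 0) := by
    rw [e]
    exact hCM.sub hai
  have := nonneg_of_moments_nonneg (g := fun t => C * herglotzMajorant t - a t) hL hgi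
    ((continuous_herglotzMajorant.continuousAt.const_mul C).sub hac) ?_
  · rw [herglotzMajorant] at this
    linarith
  · intro k m
    rw [← signedDiff_laplace k m hgi]
    have e2 : signedDiff k m s₀ (fun s => ∫ t in Ioi 0, Real.exp (-(s * t)) *
        (C * herglotzMajorant t - a t)) = C * signedDiff k m s₀ (fun s => ∫ t in Ioi 0,
          Real.exp (-(s * t)) * herglotzMajorant t) -
          (signedDiff k m s₀ (fun s => (F s).re / (1 + s) ^ 2) -
            signedDiff k m s₀ (fun s => (H s).re / (1 + s) ^ 2)) := by
      rw [← signedDiff_sub, ← signedDiff_const_mul, ← signedDiff_sub]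
      refine signedDiff_congr fun s hs => ?_
      rw [← sub_div, ← ha s hs, ← integral_const_mul, ← integral_sub]
      · congr 1
        funext t
        ring
      · exact (integrableOn_herglotzMajorant (by linarith)).const_mul C
      · exact integrableOn_exp_mul_of_le hs hai
    rw [e2]
    have h1 := (abs_le.1 (signedDiff_re_le hF hFpos k m hs₀)).2
    have h2 := (abs_le.1 (signedDiff_re_le hH hHpos k m hs₀)).1
    rw [hC, add_mul]
    linarith

end

section

open Metric Set

/-- A zero-free holomorphic function on a ball has a holomorphic logarithm. -/
theorem exists_log_on_ball {G : ℂ → ℂ} {R : ℝ} (hR : 0 < R)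
    (hG : DifferentiableOn ℂ G (ball 0 R)) (hnz : ∀ z ∈ ball (0 : ℂ) R, G z ≠ 0) :
    ∃ h : ℂ → ℂ, DifferentiableOn ℂ h (ball 0 R) ∧ h 0 = 0 ∧
      ∀ z ∈ ball (0 : ℂ) R, G z = G 0 * Complex.exp (h z) := by
  have hG' : DifferentiableOn ℂ (deriv G) (ball 0 R) := hG.deriv isOpen_ball
  obtain ⟨g, hg⟩ := (hG'.div hG hnz).isExactOn_ball
  have h0 : (0 : ℂ) ∈ ball (0 : ℂ) R := mem_ball_self hR
  refine ⟨fun z => g z - g 0, ?_, by simp, ?_⟩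
  · exact fun z hz => ((hg z hz).differentiableAt.sub_const _).differentiableWithinAt
  · have hd : ∀ z ∈ ball (0 : ℂ) R,
        HasDerivAt (fun z => G z * Complex.exp (-(g z - g 0))) 0 z := by
      intro z hz
      have h1 : HasDerivAt G (deriv G z) z :=
        (hG.differentiableAt (isOpen_ball.mem_nhds hz)).hasDerivAt
      have h2 := h1.mul (((hg z hz).sub_const (g 0)).neg.cexp)
      have h3 := hnz z hz
      have e : deriv G z * Complex.exp (-(g z - g 0)) +
          G z * (Complex.exp (-(g z - g 0)) * -((deriv G / G) z)) = 0 := by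
        simp only [Pi.div_apply]
        field_simp
        ring
      exact HasDerivAt.congr_deriv h2 e
    intro z hz
    have := (convex_ball (0 : ℂ) R).is_const_of_fderivWithin_eq_zero (𝕜 := ℂ)
      (f := fun z => G z * Complex.exp (-(g z - g 0)))
      (fun z hz => (hd z hz).differentiableAt.differentiableWithinAt) (fun z hz => by
        rw [fderivWithin_of_isOpen isOpen_ball hz]
        ext
        simpa using (hd z hz).deriv) hz h0
    simp only [sub_self, neg_zero, Complex.exp_zero, mul_one] at this
    rw [← this, mul_assoc, ← Complex.exp_add]
    simp

/-- A lower bound for a zero-free function on a ball in terms of an upper bound and of its value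
at the centre. -/
theorem norm_ge_of_ball {G : ℂ → ℂ} {c : ℂ} {R r A B : ℝ} (hr : r < R) (hr0 : 0 ≤ r)
    (hG : DifferentiableOn ℂ G (ball c R)) (hnz : ∀ z ∈ ball c R, G z ≠ 0)
    (hA : ∀ z ∈ ball c R, ‖G z‖ ≤ Real.exp A) (hB : Real.exp (-B) ≤ ‖G c‖) (hAB : 0 < A + B)
    {z : ℂ} (hz : ‖z - c‖ ≤ r) :
    Real.exp (-(B + 2 * (A + B) * R / (R - r))) ≤ ‖G z‖ := by
  have hR : 0 < R := hr0.trans_lt hr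
  obtain ⟨h, hd, h0, hh⟩ := exists_log_on_ball (G := fun z => G (z + c)) hR
    (hG.comp (by fun_prop) fun z hz => by simpa using hz)
    (fun z hz => hnz _ (by simpa using hz))
  simp only [zero_add] at hh
  have hzb : z - c ∈ ball (0 : ℂ) R := by simpa using hz.trans_lt hr
  have hGc : 0 < ‖G c‖ := (Real.exp_pos _).trans_le hB
  have hmaps : MapsTo h (ball 0 R) {z | z.re ≤ A + B} := by
    intro w hw
    have h1 := hA (w + c) (by simpa using hw)
    rw [hh w hw, norm_mul, Complex.norm_exp] at h1
    have h2 : Real.exp (-B) * Real.exp (h w).re ≤ Real.exp A :=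
      (mul_le_mul_of_nonneg_right hB (Real.exp_pos _).le).trans h1
    rw [← Real.exp_add, Real.exp_le_exp] at h2
    simp only [mem_ofPred_eq]
    linarith
  have hbc := Complex.borelCaratheodory_zero hAB hd hmaps hR hzb h0
  have h3 : 2 * (A + B) * ‖z - c‖ / (R - ‖z - c‖) ≤ 2 * (A + B) * R / (R - r) := by
    have : 0 < R - r := by linarith
    gcongr
    exact hz.trans hr.le
  have h4 := (abs_le.1 ((Complex.abs_re_le_norm _).trans (hbc.trans h3))).1
  have h5 := hh _ hzb
  rw [sub_add_cancel] at h5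
  rw [h5, norm_mul, Complex.norm_exp]
  have : Real.exp (-(B + 2 * (A + B) * R / (R - r))) =
      Real.exp (-B) * Real.exp (-(2 * (A + B) * R / (R - r))) := by
    rw [← Real.exp_add]; ring_nf
  rw [this]
  gcongr

/-- The hypotheses under which the logarithmic derivative has nonnegative real part to the right
of the critical line. -/
structure XiLike (G : ℂ → ℂ) : Prop where
  diff : Differentiable ℂ G
  symm : ∀ s, ‖G (1 - (starRingEnd ℂ) s)‖ = ‖G s‖
  ne_zero : ∀ s : ℂ, 1 / 2 < s.re → G s ≠ 0
  upper : ∀ a b : ℝ, ∃ C : ℝ, ∀ s : ℂ, a ≤ s.re → s.re ≤ b → ‖G s‖ ≤ Real.exp (C * (1 + |s.im|))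
  lower : ∀ σ : ℝ, 3 ≤ σ → ∃ C : ℝ, ∀ t : ℝ,
    Real.exp (-(C * (1 + |t|))) ≤ ‖G (σ + t * Complex.I)‖
  right : ∀ h : ℝ, 0 < h → h < 1 → ∀ σ₀ : ℝ, ∃ σ : ℝ, σ₀ ≤ σ ∧
    ∀ s : ℂ, s.re = σ → ‖G (s - h)‖ ≤ ‖G s‖

theorem XiLike.exists_lower {G : ℂ → ℂ} (hG : XiLike G) {σ₁ σ₂ : ℝ} (h1 : 1 / 2 < σ₁)
    (h2 : 3 ≤ σ₂) (h12 : σ₁ ≤ σ₂) : ∃ C : ℝ, 0 ≤ C ∧ ∀ s : ℂ, σ₁ ≤ s.re → s.re ≤ σ₂ →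
      Real.exp (-(C * (1 + |s.im|))) ≤ ‖G s‖ := by
  set R := σ₂ - 1 / 2 with hRdef
  obtain ⟨A, hA⟩ := hG.upper (1 / 2) (σ₂ + R)
  obtain ⟨B, hB⟩ := hG.lower σ₂ h2
  set A' := |A| * (1 + R) + 1 with hA'
  set B' := |B| with hB'
  have hR : 0 < R := by rw [hRdef]; linarith
  have hA'0 : 0 < A' := by positivity
  have hB'0 : 0 ≤ B' := abs_nonneg _
  have hd : 0 < R - (σ₂ - σ₁) := by rw [hRdef]; linarith
  refine ⟨B' + 2 * (A' + B') * R / (R - (σ₂ - σ₁)), by positivity, fun s hs1 hs2 => ?_⟩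
  set c : ℂ := σ₂ + s.im * Complex.I with hc
  have hball : ∀ z ∈ ball c R, |z.re - σ₂| < R ∧ |z.im| ≤ R + |s.im| := by
    intro z hz
    rw [mem_ball, dist_eq_norm] at hz
    have e1 := (Complex.abs_re_le_norm (z - c)).trans_lt hz
    have e2 := (Complex.abs_im_le_norm (z - c)).trans_lt hz
    simp [hc] at e1 e2
    refine ⟨e1, ?_⟩
    have := abs_sub_abs_le_abs_sub z.im s.im
    linarith
  have key := norm_ge_of_ball (G := G) (c := c) (R := R) (r := σ₂ - σ₁) (A := A' * (1 + |s.im|))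
    (B := B' * (1 + |s.im|)) (z := s) (by linarith) (by linarith) hG.diff.differentiableOn ?_ ?_ ?_
    (by positivity) ?_
  · refine le_trans (le_of_eq ?_) key
    congr 1
    ring
  · intro z hz
    have := (abs_lt.1 (hball z hz).1).1
    exact hG.ne_zero z (by linarith)
  · intro z hz
    have h3 := abs_lt.1 (hball z hz).1
    refine (hA z (by linarith) (by linarith)).trans (Real.exp_le_exp.2 ?_)
    have h4 := (hball z hz).2
    have h5 : A * (1 + |z.im|) ≤ |A| * (1 + |z.im|) :=
      mul_le_mul_of_nonneg_right (le_abs_self A) (by positivity)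
    have h6 : |A| * (1 + |z.im|) ≤ |A| * (1 + (R + |s.im|)) := by gcongr
    have h7 : 0 ≤ |A| * (R * |s.im|) := by positivity
    have h8 : 0 ≤ |s.im| := abs_nonneg _
    rw [hA']
    linarith
  · refine le_trans (Real.exp_le_exp.2 ?_) (hB s.im)
    have : B * (1 + |s.im|) ≤ |B| * (1 + |s.im|) :=
      mul_le_mul_of_nonneg_right (le_abs_self B) (by positivity)
    linarith
  · have : s - c = ((s.re - σ₂ : ℝ) : ℂ) := by
      apply Complex.ext <;> simp [hc]
    rw [this, Complex.norm_real, Real.norm_eq_abs, abs_of_nonpos (by linarith)]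
    linarith

theorem XiLike.norm_sub_le {G : ℂ → ℂ} (hG : XiLike G) {h : ℝ} (h0 : 0 < h) (h1 : h < 1) {s : ℂ}
    (hs : 1 / 2 + h / 2 ≤ s.re) : ‖G (s - h)‖ ≤ ‖G s‖ := by
  obtain ⟨σ₂, hσ, hσr⟩ := hG.right h h0 h1 (max 3 s.re)
  have h3 : 3 ≤ σ₂ := (le_max_left _ _).trans hσ
  have hsσ : s.re ≤ σ₂ := (le_max_right _ _).trans hσ
  set σ₁ := 1 / 2 + h / 2 with hσ₁
  obtain ⟨B, hB0, hB⟩ := hG.exists_lower (σ₁ := σ₁) (σ₂ := σ₂) (by linarith) h3 (by linarith)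
  obtain ⟨A, hA⟩ := hG.upper (σ₁ - h) σ₂
  have hnz : ∀ z : ℂ, σ₁ ≤ z.re → G z ≠ 0 := fun z hz => hG.ne_zero z (by linarith)
  have hcl : closure (Complex.re ⁻¹' Ioo σ₁ σ₂) ⊆ Complex.re ⁻¹' Icc σ₁ σ₂ :=
    closure_minimal (preimage_mono Ioo_subset_Icc_self)
      (isClosed_Icc.preimage Complex.continuous_re)
  have hshift : Differentiable ℂ fun z => G (z - h) := hG.diff.comp (by fun_prop)
  have key := PhragmenLindelof.vertical_strip (a := σ₁) (b := σ₂) (C := 1)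
    (f := fun z => G (z - h) / G z) (z := s) ?_ ?_ ?_ ?_ hs hsσ
  · rw [norm_div, div_le_one (norm_pos_iff.2 (hnz s hs))] at key
    exact key
  · refine DifferentiableOn.diffContOnCl ?_
    refine (hshift.differentiableOn).div hG.diff.differentiableOn fun z hz => hnz z (hcl hz).1
  · have hlt : 0 < σ₂ - σ₁ := by linarith
    set c := Real.pi / (σ₂ - σ₁) / 2 with hc
    have hcpos : 0 < c := by positivity
    refine ⟨c, by rw [hc]; exact half_lt_self (by positivity), (|A| + B) * (1 + 1 / c), ?_⟩
    refine Asymptotics.IsBigO.of_bound 1 ?_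
    refine Filter.Eventually.filter_mono inf_le_right ?_
    rw [Filter.eventually_principal]
    intro z hz
    have hz1 : σ₁ ≤ z.re := hz.1.le
    have hz2 : z.re ≤ σ₂ := hz.2.le
    have hl := hB z hz1 hz2
    have hu := hA (z - h) (by simp; linarith) (by simp; linarith)
    simp only [Complex.sub_im, Complex.ofReal_im, sub_zero] at hu
    have habs : 0 ≤ |z.im| := abs_nonneg _
    have hexp : 1 + |z.im| ≤ (1 + 1 / c) * Real.exp (c * |z.im|) := by
      have e1 := Real.add_one_le_exp (c * |z.im|)
      have e2 : |z.im| = 1 / c * (c * |z.im|) := by field_simp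
      have e3 : 0 < 1 / c := by positivity
      have e4 : 1 / c * (c * |z.im|) ≤ 1 / c * Real.exp (c * |z.im|) := by
        gcongr
        linarith
      have e5 : 0 ≤ c * |z.im| := by positivity
      linarith
    have hu' : ‖G (z - h)‖ ≤ Real.exp (|A| * (1 + |z.im|)) :=
      hu.trans (Real.exp_le_exp.2 (mul_le_mul_of_nonneg_right (le_abs_self A) (by positivity)))
    rw [norm_div, one_mul, Real.norm_eq_abs, abs_of_pos (Real.exp_pos _)]
    calc ‖G (z - h)‖ / ‖G z‖ ≤ Real.exp (|A| * (1 + |z.im|)) / Real.exp (-(B * (1 + |z.im|))) := by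
          gcongr
      _ = Real.exp ((|A| + B) * (1 + |z.im|)) := by
          rw [← Real.exp_sub]; ring_nf
      _ ≤ _ := by
          rw [Real.exp_le_exp, mul_assoc]
          gcongr
  · intro z hz
    have e : z - h = 1 - (starRingEnd ℂ) z := by
      apply Complex.ext
      · simp [hz, hσ₁]; ring
      · simp
    rw [norm_div, e, hG.symm, div_self (norm_ne_zero_iff.2 (hnz z hz.ge))]
  · intro z hz
    rw [norm_div, div_le_one (norm_pos_iff.2 (hnz z (by linarith)))]
    exact hσr z hz

theorem XiLike.re_logDeriv_nonneg {G : ℂ → ℂ} (hG : XiLike G) {s : ℂ} (hs : 1 / 2 < s.re) :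
    0 ≤ (logDeriv G s).re := by
  have hGs := hG.ne_zero s hs
  have hd : HasDerivAt (fun t : ℝ => (G (s - t) / G s).re) (-(logDeriv G s).re) 0 := by
    have h1 : HasDerivAt (fun w : ℂ => G (s - w) / G s) (-(logDeriv G s)) ((0 : ℝ) : ℂ) := by
      have h2 : HasDerivAt (fun w : ℂ => s - w) (-1) ((0 : ℝ) : ℂ) := by
        simpa using (hasDerivAt_id ((0 : ℝ) : ℂ)).const_sub s
      have h3 : HasDerivAt G (deriv G s) (s - ((0 : ℝ) : ℂ)) := by
        simpa using hG.diff.differentiableAt.hasDerivAt (x := s)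
      have h4 := (h3.comp ((0 : ℝ) : ℂ) h2).div_const (G s)
      have e : deriv G s * -1 / G s = -(logDeriv G s) := by
        rw [logDeriv_apply]
        ring
      rw [e] at h4
      exact h4
    simpa using h1.real_of_complex
  have hlim := hd.tendsto_slope_zero_right
  have hle : -(logDeriv G s).re ≤ 0 := by
    refine le_of_tendsto hlim ?_
    have hpos : (0 : ℝ) < min 1 (2 * s.re - 1) := lt_min one_pos (by linarith)
    filter_upwards [Ioo_mem_nhdsGT hpos] with t ht
    have ht1 := ht.2.trans_le (min_le_left _ _)
    have ht2 := ht.2.trans_le (min_le_right _ _)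
    have hn := hG.norm_sub_le ht.1 ht1 (s := s) (by linarith)
    have h5 : (G (s - t) / G s).re ≤ 1 := by
      refine (Complex.re_le_norm _).trans ?_
      rwa [norm_div, div_le_one (norm_pos_iff.2 hGs)]
    simp only [zero_add, Complex.ofReal_zero, sub_zero, div_self hGs, Complex.one_re, smul_eq_mul]
    exact mul_nonpos_of_nonneg_of_nonpos (inv_nonneg.2 ht.1.le) (by linarith)
  linarith

end

section

open Complex Filter Topology

theorem norm_betaIntegral_le {z : ℂ} {η : ℝ} :
    ‖betaIntegral z η‖ ≤ ‖betaIntegral (z.re : ℂ) η‖ := by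
  have key : ∀ t ∈ Set.Ioo (0:ℝ) 1, ∀ w : ℂ, w.re = z.re →
      ‖(t : ℂ) ^ (w - 1) * (1 - (t : ℂ)) ^ ((η : ℂ) - 1)‖ = t ^ (z.re - 1) * (1 - t) ^ (η - 1) := by
    intro t ht w hw
    have h1 : (1 - (t : ℂ)) = ((1 - t : ℝ) : ℂ) := by push_cast; ring
    rw [norm_mul, h1, norm_cpow_eq_rpow_re_of_pos ht.1,
      norm_cpow_eq_rpow_re_of_pos (by linarith [ht.2])]
    simp [hw]
  have hreal : betaIntegral (z.re : ℂ) η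
      = ((∫ t in (0:ℝ)..1, t ^ (z.re - 1) * (1 - t) ^ (η - 1) : ℝ) : ℂ) := by
    rw [betaIntegral, ← intervalIntegral.integral_ofReal]
    refine intervalIntegral.integral_congr ?_
    intro t ht
    rw [Set.uIcc_of_le zero_le_one] at ht
    simp only [ofReal_mul]
    rw [ofReal_cpow ht.1, ofReal_cpow (by linarith [ht.2])]
    push_cast
    rfl
  have hnn : 0 ≤ ∫ t in (0:ℝ)..1, t ^ (z.re - 1) * (1 - t) ^ (η - 1) :=
    intervalIntegral.integral_nonneg zero_le_one fun t ht =>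
      mul_nonneg (Real.rpow_nonneg ht.1 _) (Real.rpow_nonneg (by linarith [ht.2]) _)
  rw [hreal, norm_real, Real.norm_of_nonneg hnn, betaIntegral]
  refine (intervalIntegral.norm_integral_le_integral_norm zero_le_one).trans (le_of_eq ?_)
  rw [intervalIntegral.integral_of_le zero_le_one, intervalIntegral.integral_of_le zero_le_one,
    MeasureTheory.integral_Ioc_eq_integral_Ioo, MeasureTheory.integral_Ioc_eq_integral_Ioo]
  exact MeasureTheory.setIntegral_congr_fun measurableSet_Ioo fun t ht => key t ht z rfl

theorem norm_Gamma_mul_le {z : ℂ} (hz : 0 < z.re) {η : ℝ} (hη : 0 < η) :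
    ‖Gamma z‖ * Real.Gamma (z.re + η) ≤ ‖Gamma (z + η)‖ * Real.Gamma z.re := by
  have hη' : 0 < ((η : ℂ)).re := by simpa
  have h1 := Gamma_mul_Gamma_eq_betaIntegral hz hη'
  have h2 := Gamma_mul_Gamma_eq_betaIntegral (s := (z.re : ℂ)) (by simpa using hz) hη'
  have e1 := congrArg (‖·‖) h1
  have e2 := congrArg (‖·‖) h2
  simp only [norm_mul] at e1 e2
  rw [← ofReal_add, Gamma_ofReal, Gamma_ofReal, Gamma_ofReal, norm_real, norm_real, norm_real,
    Real.norm_of_nonneg (Real.Gamma_pos_of_pos hz).le,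
    Real.norm_of_nonneg (Real.Gamma_pos_of_pos hη).le,
    Real.norm_of_nonneg (Real.Gamma_pos_of_pos (by positivity)).le] at e2
  rw [Gamma_ofReal, norm_real, Real.norm_of_nonneg (Real.Gamma_pos_of_pos hη).le] at e1
  have hb := norm_betaIntegral_le (z := z) (η := η)
  have p1 := Real.Gamma_pos_of_pos hη
  have p2 : 0 < Real.Gamma (z.re + η) := Real.Gamma_pos_of_pos (by positivity)
  refine le_of_mul_le_mul_right ?_ p1
  calc ‖Gamma z‖ * Real.Gamma (z.re + η) * Real.Gamma η
      = ‖Gamma (z + η)‖ * ‖betaIntegral z η‖ * Real.Gamma (z.re + η) := by rw [← e1]; ring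
    _ ≤ ‖Gamma (z + η)‖ * ‖betaIntegral z.re η‖ * Real.Gamma (z.re + η) := by gcongr
    _ = ‖Gamma (z + η)‖ * (Real.Gamma (z.re + η) * ‖betaIntegral z.re η‖) := by ring
    _ = _ := by rw [← e2]; ring

/-- The digamma function on the real axis. -/
noncomputable def rdigamma (x : ℝ) : ℝ := (digamma x).re

theorem differentiableAt_Gamma_of_re_pos {z : ℂ} (hz : 0 < z.re) : DifferentiableAt ℂ Gamma z :=
  differentiableAt_Gamma z fun m h => by
    rw [h] at hz
    simp at hz
    linarith [(Nat.cast_nonneg m : (0:ℝ) ≤ m)]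

theorem hasDerivAt_log_Gamma {x : ℝ} (hx : 0 < x) :
    HasDerivAt (fun x => Real.log (Real.Gamma x)) (rdigamma x) x := by
  have h := (differentiableAt_Gamma_of_re_pos (z := x) (by simpa)).hasDerivAt.real_of_complex
  have e : (fun x : ℝ => (Gamma x).re) = Real.Gamma := by
    funext y; rw [Gamma_ofReal, ofReal_re]
  rw [e] at h
  refine (h.log (Real.Gamma_pos_of_pos hx).ne').congr_deriv ?_
  rw [rdigamma, digamma_def, logDeriv_apply, Gamma_ofReal, div_ofReal_re]

theorem rdigamma_add_one {x : ℝ} (hx : 0 < x) : rdigamma (x + 1) = rdigamma x + 1 / x := by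
  have := digamma_apply_add_one (x : ℂ) (fun m h => by
    have := congrArg re h
    simp at this
    linarith [(Nat.cast_nonneg m : (0:ℝ) ≤ m)])
  simp only [rdigamma]
  push_cast
  rw [this, add_re]
  congr 1
  rw [← ofReal_inv, ofReal_re, one_div]

theorem rdigamma_monotoneOn : MonotoneOn rdigamma (Set.Ioi 0) := by
  intro x hx y hy hxy
  have h := Real.convexOn_log_Gamma.monotoneOn_deriv
    (fun z hz => (hasDerivAt_log_Gamma hz).differentiableAt) hx hy hxy
  have e : ∀ z : ℝ, 0 < z → deriv (Real.log ∘ Real.Gamma) z = rdigamma z := fun z hz =>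
    (hasDerivAt_log_Gamma hz).deriv
  rwa [e x hx, e y hy] at h

theorem rdigamma_le_log {x : ℝ} (hx : 0 < x) : rdigamma x ≤ Real.log x := by
  have h := Real.convexOn_log_Gamma.le_slope_of_hasDerivAt hx
    (Set.mem_Ioi.mpr (by linarith : (0:ℝ) < x + 1)) (by linarith) (hasDerivAt_log_Gamma hx)
  rw [slope_def_field] at h
  simp only [Function.comp_apply] at h
  rw [Real.Gamma_add_one hx.ne', Real.log_mul hx.ne' (Real.Gamma_pos_of_pos hx).ne'] at h
  simpa using h

theorem log_le_rdigamma_add_one {x : ℝ} (hx : 0 < x) : Real.log x ≤ rdigamma (x + 1) := by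
  have h := Real.convexOn_log_Gamma.slope_le_of_hasDerivAt hx
    (Set.mem_Ioi.mpr (by linarith : (0:ℝ) < x + 1)) (by linarith)
    (hasDerivAt_log_Gamma (by linarith : (0:ℝ) < x + 1))
  rw [slope_def_field] at h
  simp only [Function.comp_apply] at h
  rw [Real.Gamma_add_one hx.ne', Real.log_mul hx.ne' (Real.Gamma_pos_of_pos hx).ne'] at h
  simpa using h

theorem rdigamma_re_le {z : ℂ} (hz : 0 < z.re) : rdigamma z.re ≤ (digamma z).re := by
  have hGz := Gamma_ne_zero_of_re_pos hz
  have hx : 0 < ((z.re : ℝ) : ℂ).re := by simpa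
  have hGx := Gamma_ne_zero_of_re_pos hx
  have shift : ∀ u : ℂ, 0 < u.re →
      HasDerivAt (fun w : ℂ => Gamma (u + w)) (digamma u * Gamma u) ((0 : ℝ) : ℂ) := by
    intro u hu
    have h1 : HasDerivAt (fun w : ℂ => u + w) 1 ((0 : ℝ) : ℂ) := by
      simpa using (hasDerivAt_id ((0 : ℝ) : ℂ)).const_add u
    have h2 : HasDerivAt Gamma (deriv Gamma u) (u + ((0 : ℝ) : ℂ)) := by
      simpa using (differentiableAt_Gamma_of_re_pos hu).hasDerivAt
    refine (h2.comp ((0 : ℝ) : ℂ) h1).congr_deriv ?_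
    rw [digamma_def, logDeriv_apply, div_mul_cancel₀ _ (Gamma_ne_zero_of_re_pos hu), mul_one]
  have hd : HasDerivAt (fun t : ℝ => (Gamma (z.re + t) / Gamma (z + t) * (Gamma z / Gamma z.re)).re)
      (rdigamma z.re - (digamma z).re) 0 := by
    have h1 := (((shift z.re hx).div (shift z hz) (by simpa using hGz)).mul_const
      (Gamma z / Gamma z.re)).real_of_complex
    refine h1.congr_deriv ?_
    rw [rdigamma, ← sub_re]
    congr 1
    simp only [ofReal_zero, add_zero]
    field_simp
  have hlim := hd.tendsto_slope_zero_right
  have hle : rdigamma z.re - (digamma z).re ≤ 0 := by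
    refine le_of_tendsto hlim ?_
    filter_upwards [self_mem_nhdsWithin] with t (ht : 0 < t)
    have hn := norm_Gamma_mul_le hz ht
    have hGzt : Gamma (z + t) ≠ 0 := Gamma_ne_zero_of_re_pos (by simpa using by positivity)
    have e0 : Gamma z.re / Gamma z * (Gamma z / Gamma z.re) = 1 := by field_simp
    have h5 : (Gamma (z.re + t) / Gamma (z + t) * (Gamma z / Gamma z.re)).re ≤ 1 := by
      refine (Complex.re_le_norm _).trans ?_
      rw [norm_mul, norm_div, norm_div, ← ofReal_add, Gamma_ofReal, Gamma_ofReal, norm_real,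
        norm_real, Real.norm_of_nonneg (Real.Gamma_pos_of_pos hz).le,
        Real.norm_of_nonneg (Real.Gamma_pos_of_pos (by positivity)).le, div_mul_div_comm,
        div_le_one (mul_pos (norm_pos_iff.mpr hGzt) (Real.Gamma_pos_of_pos hz))]
      rwa [mul_comm]
    simp only [zero_add, ofReal_zero, add_zero, e0, one_re, smul_eq_mul]
    exact mul_nonpos_of_nonneg_of_nonpos (inv_nonneg.2 ht.le) (by linarith)
  linarith

theorem Gamma_sub_le {x η : ℝ} (hx : 1 < x) (hη : 0 < η) (hη1 : η < 1) :
    Real.Gamma (x - η) ≤ (x - 1) ^ (-η) * Real.Gamma x := by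
  have h := Real.Gamma_mul_add_mul_le_rpow_Gamma_mul_rpow_Gamma (s := x) (t := x - 1) (a := 1 - η)
    (b := η) (by linarith) (by linarith) (by linarith) hη (by ring)
  have e : (1 - η) * x + η * (x - 1) = x - η := by ring
  have hx1 : 0 < x - 1 := by linarith
  have hG : Real.Gamma x = (x - 1) * Real.Gamma (x - 1) := by
    have := Real.Gamma_add_one hx1.ne'
    rwa [sub_add_cancel] at this
  have hp := Real.Gamma_pos_of_pos hx1
  rw [e] at h
  refine h.trans (le_of_eq ?_)
  rw [hG, Real.mul_rpow hx1.le hp.le, mul_assoc, ← Real.rpow_add hp, Real.rpow_neg hx1.le,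
    Real.rpow_sub hx1, Real.rpow_one]
  simp
  ring

theorem norm_sin_le_exp (w : ℂ) : ‖sin w‖ ≤ Real.exp |w.im| := by
  rw [sin]
  have h1 : ‖cexp (-w * I)‖ ≤ Real.exp |w.im| := by
    rw [norm_exp]; simp [le_abs_self]
  have h2 : ‖cexp (w * I)‖ ≤ Real.exp |w.im| := by
    rw [norm_exp]; simp [neg_le_abs]
  rw [norm_div, norm_mul, norm_I, mul_one]
  have := norm_sub_le (cexp (-w * I)) (cexp (w * I))
  simp only [Complex.norm_ofNat]
  linarith

theorem exp_le_norm_Gamma_half (t : ℝ) :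
    Real.exp (-(Real.pi * |t|)) ≤ ‖Gamma (1 / 2 + t * I)‖ ^ 2 := by
  have h := Gamma_mul_Gamma_one_sub (1 / 2 + t * I)
  have e : (1 : ℂ) - (1 / 2 + t * I) = (starRingEnd ℂ) (1 / 2 + t * I) := by
    simp [Complex.ext_iff]; norm_num
  rw [e, Gamma_conj] at h
  have h' := congrArg (‖·‖) h
  simp only [norm_mul, norm_div, RCLike.norm_conj] at h'
  rw [sq, h', norm_real, Real.norm_of_nonneg Real.pi_pos.le, Real.exp_neg]
  have hs := norm_sin_le_exp (Real.pi * (1 / 2 + t * I))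
  have him : ((Real.pi : ℂ) * (1 / 2 + t * I)).im = Real.pi * t := by simp
  rw [him, abs_mul, abs_of_pos Real.pi_pos] at hs
  have hne : 0 < ‖sin (Real.pi * (1 / 2 + t * I))‖ := by
    rcases (norm_nonneg (sin (Real.pi * (1 / 2 + t * I)))).eq_or_lt with h0 | h0
    · exfalso
      rw [← h0, div_zero] at h'
      have hG : Gamma (1 / 2 + t * I) ≠ 0 := Gamma_ne_zero_of_re_pos (by simp)
      have := norm_pos_iff.mpr hG
      nlinarith
    · exact h0
  rw [inv_eq_one_div]
  rw [div_le_div_iff₀ (Real.exp_pos _) hne]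
  nlinarith [Real.pi_gt_three, Real.exp_pos (Real.pi * |t|)]

/-- A vertical-line lower bound for the Gamma function. -/
theorem exists_exp_le_norm_Gamma {x : ℝ} (hx : 1 / 2 ≤ x) :
    ∃ C : ℝ, ∀ t : ℝ, Real.exp (-(C * (1 + |t|))) ≤ ‖Gamma (x + t * I)‖ := by
  have half : ∀ t : ℝ, Real.exp (-(Real.pi * |t|)) ≤ ‖Gamma (1 / 2 + t * I)‖ := by
    intro t
    have h := exp_le_norm_Gamma_half t
    have h1 : Real.exp (-(Real.pi * |t|)) ≤ 1 := by
      rw [Real.exp_le_one_iff]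
      have := mul_nonneg Real.pi_pos.le (abs_nonneg t)
      linarith
    refine le_of_sq_le_sq ?_ (norm_nonneg _)
    refine le_trans ?_ h
    nlinarith [Real.exp_pos (-(Real.pi * |t|))]
  rcases hx.eq_or_lt with rfl | hx
  · refine ⟨Real.pi, fun t => ?_⟩
    have h := half t
    push_cast
    refine le_trans (Real.exp_le_exp.mpr ?_) h
    nlinarith [Real.pi_pos, abs_nonneg t]
  · set c := Real.Gamma x / Real.Gamma (1 / 2) with hc
    have hcpos : 0 < c := div_pos (Real.Gamma_pos_of_pos (by linarith))
      (Real.Gamma_pos_of_pos (by norm_num))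
    have hle : ∀ t : ℝ, c * Real.exp (-(Real.pi * |t|)) ≤ ‖Gamma (x + t * I)‖ := by
      intro t
      have h := norm_Gamma_mul_le (z := 1 / 2 + t * I) (by simp) (η := x - 1 / 2) (by linarith)
      have hre : (1 / 2 + t * I : ℂ).re = 1 / 2 := by simp
      rw [hre] at h
      have e1 : (1 / 2 : ℝ) + (x - 1 / 2) = x := by ring
      have e2 : (1 / 2 + t * I : ℂ) + ((x - 1 / 2 : ℝ) : ℂ) = x + t * I := by push_cast; ring
      rw [e1, e2] at h
      have := half t
      rw [hc, div_mul_eq_mul_div, div_le_iff₀ (Real.Gamma_pos_of_pos (by norm_num))]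
      refine le_trans ?_ h
      rw [mul_comm]
      have := Real.Gamma_pos_of_pos (show 0 < x by linarith)
      gcongr
    refine ⟨Real.pi + |Real.log c|, fun t => le_trans ?_ (hle t)⟩
    rw [← Real.exp_log hcpos, ← Real.exp_add, Real.exp_log hcpos]
    refine Real.exp_le_exp.mpr ?_
    have := neg_abs_le (Real.log c)
    have := mul_nonneg (abs_nonneg (Real.log c)) (abs_nonneg t)
    have := Real.pi_pos
    nlinarith

end

section

open Complex Filter Topology MeasureTheory Set HurwitzZeta

/-- At most exponential growth in vertical strips. -/
def ExpBounded (G : ℂ → ℂ) : Prop :=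
  ∀ a b : ℝ, ∃ C : ℝ, ∀ s : ℂ, a ≤ s.re → s.re ≤ b → ‖G s‖ ≤ Real.exp (C * (1 + |s.im|))

theorem ExpBounded.of_bounded {G : ℂ → ℂ}
    (h : ∀ a b : ℝ, ∃ C : ℝ, ∀ s : ℂ, a ≤ s.re → s.re ≤ b → ‖G s‖ ≤ C) : ExpBounded G := by
  intro a b
  obtain ⟨C, hC⟩ := h a b
  refine ⟨|C|, fun s h1 h2 => (hC s h1 h2).trans ?_⟩
  have h3 := Real.add_one_le_exp (|C| * (1 + |s.im|))
  have h4 := mul_nonneg (abs_nonneg C) (abs_nonneg s.im)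
  have h5 := le_abs_self C
  linarith

theorem ExpBounded.mul {G H : ℂ → ℂ} (hG : ExpBounded G) (hH : ExpBounded H) :
    ExpBounded (fun s => G s * H s) := by
  intro a b
  obtain ⟨C, hC⟩ := hG a b
  obtain ⟨D, hD⟩ := hH a b
  refine ⟨C + D, fun s h1 h2 => ?_⟩
  rw [norm_mul, add_mul, Real.exp_add]
  exact mul_le_mul (hC s h1 h2) (hD s h1 h2) (norm_nonneg _) (Real.exp_pos _).le

theorem ExpBounded.add {G H : ℂ → ℂ} (hG : ExpBounded G) (hH : ExpBounded H) :
    ExpBounded (fun s => G s + H s) := by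
  intro a b
  obtain ⟨C, hC⟩ := hG a b
  obtain ⟨D, hD⟩ := hH a b
  refine ⟨max C D + 1, fun s h1 h2 => ?_⟩
  have hpos : 0 ≤ 1 + |s.im| := by positivity
  have h3 : ‖G s‖ ≤ Real.exp (max C D * (1 + |s.im|)) := (hC s h1 h2).trans (by gcongr; simp)
  have h4 : ‖H s‖ ≤ Real.exp (max C D * (1 + |s.im|)) := (hD s h1 h2).trans (by gcongr; simp)
  rw [add_mul, one_mul, Real.exp_add]
  have h5 : 2 ≤ Real.exp (1 + |s.im|) := by
    linarith [Real.add_one_le_exp (1 + |s.im|), abs_nonneg s.im]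
  have h6 := Real.exp_pos (max C D * (1 + |s.im|))
  refine (norm_add_le _ _).trans ?_
  nlinarith

theorem ExpBounded.const (c : ℂ) : ExpBounded (fun _ => c) :=
  .of_bounded fun _ _ => ⟨‖c‖, fun _ _ _ => le_rfl⟩

theorem ExpBounded.id : ExpBounded (fun s => s) := by
  intro a b
  refine ⟨|a| + |b| + 1, fun s h1 h2 => ?_⟩
  have h3 := norm_le_abs_re_add_abs_im s
  have h4 : |s.re| ≤ |a| + |b| := by
    rw [abs_le]
    constructor
    · linarith [neg_abs_le a, abs_nonneg b]
    · linarith [le_abs_self b, abs_nonneg a]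
  have h5 := Real.add_one_le_exp ((|a| + |b| + 1) * (1 + |s.im|))
  nlinarith [mul_nonneg (add_nonneg (abs_nonneg a) (abs_nonneg b)) (abs_nonneg s.im),
    abs_nonneg a, abs_nonneg b]

theorem ExpBounded.sum {ι : Type*} {F : ι → ℂ → ℂ} (t : Finset ι) (h : ∀ i, ExpBounded (F i)) :
    ExpBounded (fun s => ∑ i ∈ t, F i s) := by
  classical
  induction t using Finset.induction_on with
  | empty => simpa using ExpBounded.const 0
  | insert i t hi ih =>
    simp only [Finset.sum_insert hi]
    exact (h i).add ih

theorem ExpBounded.cpow {N : ℕ} (hN : N ≠ 0) (c : ℝ) :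
    ExpBounded (fun s => (N : ℂ) ^ (c * s)) := by
  refine .of_bounded fun a b => ⟨Real.exp (|Real.log N * c| * (|a| + |b|)), fun s h1 h2 => ?_⟩
  rw [norm_natCast_cpow_of_pos (Nat.pos_of_ne_zero hN),
    Real.rpow_def_of_pos (by exact_mod_cast Nat.pos_of_ne_zero hN)]
  refine Real.exp_le_exp.mpr ?_
  have h4 : |s.re| ≤ |a| + |b| := by
    rw [abs_le]
    constructor
    · linarith [neg_abs_le a, abs_nonneg b]
    · linarith [le_abs_self b, abs_nonneg a]
  refine (le_abs_self _).trans ?_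
  rw [re_ofReal_mul, ← mul_assoc, abs_mul]
  gcongr

theorem WeakFEPair.exists_norm_Λ₀_le (P : WeakFEPair ℂ) (a b : ℝ) :
    ∃ C : ℝ, ∀ s : ℂ, a ≤ s.re → s.re ≤ b → ‖P.Λ₀ s‖ ≤ C := by
  have conv : ∀ s : ℂ, IntegrableOn (fun t : ℝ => (t : ℂ) ^ (s - 1) • P.f_modif t) (Ioi 0) :=
    fun s => (P.isStrongFEPair_toStrongFEPair.hasMellin s).1
  refine ⟨∫ t in Ioi (0:ℝ), (‖(t : ℂ) ^ ((a : ℂ) - 1) • P.f_modif t‖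
    + ‖(t : ℂ) ^ ((b : ℂ) - 1) • P.f_modif t‖), fun s h1 h2 => ?_⟩
  rw [WeakFEPair.Λ₀, mellin]
  refine (norm_integral_le_integral_norm _).trans ?_
  refine setIntegral_mono_on (conv s).norm ((conv a).norm.add (conv b).norm) measurableSet_Ioi ?_
  intro t (ht : 0 < t)
  simp only [norm_smul, norm_cpow_eq_rpow_re_of_pos ht]
  rw [← add_mul]
  refine mul_le_mul_of_nonneg_right ?_ (norm_nonneg _)
  simp only [sub_re, ofReal_re, one_re]
  have p1 := Real.rpow_nonneg ht.le (a - 1)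
  have p2 := Real.rpow_nonneg ht.le (b - 1)
  rcases le_total 1 t with h | h
  · have := Real.rpow_le_rpow_of_exponent_le h (by linarith : s.re - 1 ≤ b - 1)
    linarith
  · have := Real.rpow_le_rpow_of_exponent_ge ht h (by linarith : a - 1 ≤ s.re - 1)
    linarith

theorem expBounded_completedHurwitzZetaEven₀ (a : UnitAddCircle) :
    ExpBounded (completedHurwitzZetaEven₀ a) := by
  refine .of_bounded fun x y => ?_
  obtain ⟨C, hC⟩ := (hurwitzEvenFEPair a).exists_norm_Λ₀_le (x / 2) (y / 2)
  refine ⟨C / 2, fun s h1 h2 => ?_⟩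
  rw [completedHurwitzZetaEven₀, norm_div, Complex.norm_ofNat]
  have : (s / 2).re = s.re / 2 := by simp
  have := hC (s / 2) (by linarith) (by linarith)
  linarith

theorem expBounded_completedHurwitzZetaOdd (a : UnitAddCircle) :
    ExpBounded (completedHurwitzZetaOdd a) := by
  refine .of_bounded fun x y => ?_
  obtain ⟨C, hC⟩ := (hurwitzOddFEPair a).exists_norm_Λ₀_le ((x + 1) / 2) ((y + 1) / 2)
  refine ⟨C / 2, fun s h1 h2 => ?_⟩
  rw [completedHurwitzZetaOdd, norm_div, Complex.norm_ofNat]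
  have : ((s + 1) / 2).re = (s.re + 1) / 2 := by simp
  have h3 := hC ((s + 1) / 2) (by linarith) (by linarith)
  rw [WeakFEPair.Λ₀_eq] at h3
  simp only [hurwitzOddFEPair_f₀, hurwitzOddFEPair_g₀, smul_zero, add_zero] at h3
  linarith

theorem ZMod.expBounded_completedLFunction {N : ℕ} [NeZero N] {Φ : ZMod N → ℂ} (h0 : Φ 0 = 0)
    (hs : ∑ j, Φ j = 0) : ExpBounded (ZMod.completedLFunction Φ) := by
  have e : ZMod.completedLFunction Φ = ZMod.completedLFunction₀ Φ := by
    funext s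
    rw [ZMod.completedLFunction_eq, h0, hs]
    simp
  rw [e]
  have hN : ExpBounded (fun s => (N : ℂ) ^ (-s)) := by
    simpa using ExpBounded.cpow (NeZero.ne N) (-1)
  exact (hN.mul (.sum _ fun j => (ExpBounded.const (Φ j)).mul
      (expBounded_completedHurwitzZetaEven₀ _))).add
    (hN.mul (.sum _ fun j => (ExpBounded.const (Φ j)).mul (expBounded_completedHurwitzZetaOdd _)))

end

section

open Complex Filter Topology MeasureTheory Set

theorem norm_LSeries_sub_one_le {f : ℕ → ℂ} (h1 : f 1 = 1) (hf : ∀ n, ‖f n‖ ≤ 1) {s : ℂ}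
    (hs : 2 ≤ s.re) : ‖LSeries f s - 1‖ ≤ 2 / 3 := by
  have hz := hasSum_zeta_two
  have hbound : ∀ n : ℕ, ‖LSeries.term f s n‖ ≤ 1 / (n : ℝ) ^ 2 := by
    intro n
    rcases Nat.eq_zero_or_pos n with rfl | hn
    · simp
    rw [LSeries.term_of_ne_zero hn.ne', norm_div, norm_natCast_cpow_of_pos hn]
    have hn1 : (1 : ℝ) ≤ n := by exact_mod_cast hn
    have : (n : ℝ) ^ (2 : ℕ) ≤ (n : ℝ) ^ s.re := by
      rw [← Real.rpow_natCast]
      exact Real.rpow_le_rpow_of_exponent_le hn1 (by exact_mod_cast hs)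
    gcongr
    exact hf n
  have hsum : Summable (LSeries.term f s) := .of_norm_bounded hz.summable hbound
  have hd : HasSum (fun n : ℕ => LSeries.term f s n - if n = 1 then 1 else 0)
      (LSeries f s - 1) := hsum.hasSum.sub (hasSum_ite_eq 1 1)
  have hd' : HasSum (fun n : ℕ => 1 / (n : ℝ) ^ 2 - if n = 1 then 1 else 0)
      (Real.pi ^ 2 / 6 - 1) := hz.sub (hasSum_ite_eq 1 1)
  rw [← hd.tsum_eq]
  refine (tsum_of_norm_bounded hd' fun n => ?_).trans ?_
  · by_cases hn : n = 1
    · subst hn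
      simp [LSeries.term, h1]
    · simpa [hn] using hbound n
  · have := Real.pi_lt_d2
    nlinarith [Real.pi_pos]

theorem norm_Gammaℝ_sub_le {w : ℂ} {h : ℝ} (hh : 0 < h) (hh1 : h < 1) (hw : 3 < w.re) :
    ‖Gammaℝ (w - h)‖ ≤ Real.pi ^ (h / 2) * (w.re / 2 - 1) ^ (-(h / 2)) * ‖Gammaℝ w‖ := by
  have hre : ((w - h) / 2).re = w.re / 2 - h / 2 := by simp; ring
  have h1 := norm_Gamma_mul_le (z := (w - h) / 2) (η := h / 2) (by rw [hre]; linarith)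
    (by linarith)
  have e1 : (w - h) / 2 + ((h / 2 : ℝ) : ℂ) = w / 2 := by push_cast; ring
  rw [hre, e1, sub_add_cancel] at h1
  have h2 := Gamma_sub_le (x := w.re / 2) (η := h / 2) (by linarith) (by linarith) (by linarith)
  have hp := Real.Gamma_pos_of_pos (show 0 < w.re / 2 by linarith)
  have h3 : ‖Gamma ((w - h) / 2)‖ ≤ (w.re / 2 - 1) ^ (-(h / 2)) * ‖Gamma (w / 2)‖ := by
    refine le_of_mul_le_mul_right ?_ hp
    calc _ ≤ _ := h1
      _ ≤ ‖Gamma (w / 2)‖ * ((w.re / 2 - 1) ^ (-(h / 2)) * Real.Gamma (w.re / 2)) := by gcongr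
      _ = _ := by ring
  rw [Gammaℝ_def, Gammaℝ_def, norm_mul, norm_mul, norm_cpow_eq_rpow_re_of_pos Real.pi_pos,
    norm_cpow_eq_rpow_re_of_pos Real.pi_pos]
  have e2 : (-(w - h) / 2).re = h / 2 + (-w / 2).re := by simp; ring
  rw [e2, Real.rpow_add Real.pi_pos]
  have p1 : 0 < Real.pi ^ (h / 2) := Real.rpow_pos_of_pos Real.pi_pos _
  have p2 : 0 < Real.pi ^ (-w / 2).re := Real.rpow_pos_of_pos Real.pi_pos _
  calc _ ≤ Real.pi ^ (h / 2) * Real.pi ^ (-w / 2).re *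
        ((w.re / 2 - 1) ^ (-(h / 2)) * ‖Gamma (w / 2)‖) := by gcongr
    _ = _ := by ring

theorem exists_exp_le_norm_Gammaℝ {x : ℝ} (hx : 1 ≤ x) :
    ∃ C : ℝ, ∀ t : ℝ, Real.exp (-(C * (1 + |t|))) ≤ ‖Gammaℝ (x + t * I)‖ := by
  obtain ⟨C, hC⟩ := exists_exp_le_norm_Gamma (show 1 / 2 ≤ x / 2 by linarith)
  refine ⟨|C| + |Real.log Real.pi * (-x / 2)|, fun t => ?_⟩
  have h := hC (t / 2)
  have e : ((x / 2 : ℝ) : ℂ) + ((t / 2 : ℝ) : ℂ) * I = (x + t * I) / 2 := by push_cast; ring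
  have er : (-(x + t * I) / 2).re = -x / 2 := by simp
  rw [e] at h
  rw [Gammaℝ_def, norm_mul, norm_cpow_eq_rpow_re_of_pos Real.pi_pos, er,
    Real.rpow_def_of_pos Real.pi_pos]
  have h2 : Real.exp (-(|Real.log Real.pi * (-x / 2)| * (1 + |t|))) ≤
      Real.exp (Real.log Real.pi * (-x / 2)) := by
    refine Real.exp_le_exp.mpr ?_
    have := mul_nonneg (abs_nonneg (Real.log Real.pi * (-x / 2))) (abs_nonneg t)
    have := neg_abs_le (Real.log Real.pi * (-x / 2))
    linarith
  have h3 : Real.exp (-(|C| * (1 + |t|))) ≤ ‖Gamma ((x + t * I) / 2)‖ := by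
    refine le_trans (Real.exp_le_exp.mpr ?_) h
    rw [abs_div, abs_two]
    have := mul_le_mul_of_nonneg_right (le_abs_self C) (show 0 ≤ 1 + |t| / 2 by positivity)
    have := mul_nonneg (abs_nonneg C) (abs_nonneg t)
    nlinarith
  rw [add_mul, neg_add, Real.exp_add, mul_comm]
  exact mul_le_mul h2 h3 (Real.exp_pos _).le (Real.exp_pos _).le

theorem XiLike.of_eq_mul {G A f : ℂ → ℂ} {g : ℕ → ℂ} {δ : ℝ} (hδ : 0 ≤ δ)
    (diff : Differentiable ℂ G)
    (symm : ∀ s, ‖G (1 - (starRingEnd ℂ) s)‖ = ‖G s‖)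
    (ne_zero : ∀ s : ℂ, 1 / 2 < s.re → G s ≠ 0) (upper : ExpBounded G)
    (hG : ∀ s : ℂ, 2 ≤ s.re → G s = A s * Gammaℝ (s + δ) * f s)
    (hf : ∀ s : ℂ, 2 ≤ s.re → f s = LSeries g s) (hg1 : g 1 = 1) (hg : ∀ n, ‖g n‖ ≤ 1)
    (hA1 : ∀ s : ℂ, 3 ≤ s.re → 1 ≤ ‖A s‖)
    (hA : ∀ s : ℂ, 3 ≤ s.re → ∀ h : ℝ, 0 < h → h < 1 → ‖A (s - h)‖ ≤ ‖A s‖) : XiLike G := by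
  have hL : ∀ s : ℂ, 2 ≤ s.re → 1 / 3 ≤ ‖f s‖ ∧ ‖f s‖ ≤ 5 / 3 := by
    intro s hs
    have h := norm_LSeries_sub_one_le hg1 hg hs
    rw [← hf s hs] at h
    have h1 := norm_sub_norm_le (f s) 1
    have h2 := norm_sub_norm_le 1 (f s)
    rw [norm_sub_rev] at h2
    simp only [norm_one] at h1 h2
    constructor <;> linarith
  refine ⟨diff, symm, ne_zero, upper, fun σ hσ => ?_, fun h hh hh1 σ₀ => ?_⟩
  · obtain ⟨C, hC⟩ := exists_exp_le_norm_Gammaℝ (show 1 ≤ σ + δ by linarith)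
    refine ⟨C + 2, fun t => ?_⟩
    have hre : (σ + t * I : ℂ).re = σ := by simp
    rw [hG _ (by rw [hre]; linarith), norm_mul, norm_mul]
    have h1 := hA1 (σ + t * I) (by rw [hre]; linarith)
    have h2 := (hL (σ + t * I) (by rw [hre]; linarith)).1
    have h3 := hC t
    have e : ((σ + δ : ℝ) : ℂ) + t * I = σ + t * I + δ := by push_cast; ring
    rw [e] at h3
    have h4 : Real.exp (-(2 * (1 + |t|))) ≤ 1 / 3 := by
      rw [Real.exp_neg, inv_eq_one_div]
      refine one_div_le_one_div_of_le (by norm_num) ?_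
      linarith [Real.add_one_le_exp (2 * (1 + |t|)), abs_nonneg t]
    calc Real.exp (-((C + 2) * (1 + |t|)))
        = 1 * Real.exp (-(C * (1 + |t|))) * Real.exp (-(2 * (1 + |t|))) := by
          rw [one_mul, ← Real.exp_add]; ring_nf
      _ ≤ _ := by
          gcongr
          exact h4.trans h2
  · set σ := max σ₀ (max 5 (2 + 2 * (Real.pi * (5 : ℝ) ^ (2 / h)))) with hσ
    have hs1 : 5 ≤ σ := (le_max_left _ _).trans (le_max_right _ _)
    have hs2 : 2 + 2 * (Real.pi * (5 : ℝ) ^ (2 / h)) ≤ σ :=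
      (le_max_right _ _).trans (le_max_right _ _)
    refine ⟨σ, le_max_left _ _, fun s hs => ?_⟩
    have hwre : (s + δ).re = σ + δ := by simp [hs]
    rw [hG s (by linarith), hG (s - h) (by simp; linarith)]
    simp only [norm_mul]
    have hGam := norm_Gammaℝ_sub_le hh hh1 (w := s + δ) (by linarith)
    have e : s + δ - h = s - h + δ := by ring
    rw [e, hwre] at hGam
    have hX : Real.pi ^ (h / 2) * ((σ + δ) / 2 - 1) ^ (-(h / 2)) ≤ 1 / 5 := by
      have h5 : Real.pi * (5 : ℝ) ^ (2 / h) ≤ (σ + δ) / 2 - 1 := by linarith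
      have p5 : 0 < Real.pi * (5 : ℝ) ^ (2 / h) := by positivity
      have h6 := Real.rpow_le_rpow p5.le h5 (show 0 ≤ h / 2 by linarith)
      rw [Real.mul_rpow Real.pi_pos.le (by positivity), ← Real.rpow_mul (by norm_num),
        div_mul_div_cancel₀ hh.ne', div_self two_ne_zero, Real.rpow_one] at h6
      rw [Real.rpow_neg (p5.le.trans h5), ← div_eq_mul_inv, div_le_iff₀ (by
        refine lt_of_lt_of_le ?_ h6; positivity)]
      linarith
    have h7 := (hL (s - h) (by simp; linarith)).2
    have h8 := (hL s (by linarith)).1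
    have h9 := hA s (by linarith) h hh hh1
    calc ‖A (s - h)‖ * ‖Gammaℝ (s - h + δ)‖ * ‖f (s - h)‖
        ≤ ‖A s‖ * (1 / 5 * ‖Gammaℝ (s + δ)‖) * (5 / 3) := by
          gcongr
          exact hGam.trans (by gcongr)
      _ = ‖A s‖ * ‖Gammaℝ (s + δ)‖ * (1 / 3) := by ring
      _ ≤ _ := by gcongr

theorem norm_one_sub_conj_eq {G : ℂ → ℂ} (hd : Differentiable ℂ G)
    (hreal : ∀ x : ℝ, 1 < x → (starRingEnd ℂ) (G x) = G x)
    (hfe : ∀ s, ‖G (1 - s)‖ = ‖G s‖) (s : ℂ) : ‖G (1 - (starRingEnd ℂ) s)‖ = ‖G s‖ := by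
  have hconj : G = fun s => (starRingEnd ℂ) (G ((starRingEnd ℂ) s)) := by
    have hd' : Differentiable ℂ (fun s => (starRingEnd ℂ) (G ((starRingEnd ℂ) s))) :=
      fun s => by
        have := (hd ((starRingEnd ℂ) s)).conj_conj
        rw [Complex.conj_conj] at this
        exact this
    have h1 : AnalyticOnNhd ℂ G univ := hd.differentiableOn.analyticOnNhd isOpen_univ
    have h2 : AnalyticOnNhd ℂ (fun s => (starRingEnd ℂ) (G ((starRingEnd ℂ) s))) univ :=
      hd'.differentiableOn.analyticOnNhd isOpen_univ
    have hfr : ∃ᶠ z in 𝓝[≠] (2 : ℂ), G z = (starRingEnd ℂ) (G ((starRingEnd ℂ) z)) := by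
      have ht : Tendsto (fun n : ℕ => ((2 + 1 / ((n : ℝ) + 1) : ℝ) : ℂ)) atTop (𝓝[≠] (2 : ℂ)) := by
        refine tendsto_nhdsWithin_iff.mpr ⟨?_, .of_forall fun n => ?_⟩
        · have := (tendsto_one_div_add_atTop_nhds_zero_nat (𝕜 := ℝ)).const_add 2
          rw [add_zero] at this
          exact_mod_cast (continuous_ofReal.tendsto 2).comp this
        · have : (0 : ℝ) < 1 / ((n : ℝ) + 1) := by positivity
          simp only [mem_compl_iff, mem_singleton_iff]
          intro hc
          have := congrArg re hc
          simp only [ofReal_re, re_ofNat] at this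
          linarith
      refine ht.frequently (Eventually.frequently (.of_forall fun n => ?_))
      have : (0 : ℝ) < 1 / ((n : ℝ) + 1) := by positivity
      rw [conj_ofReal, hreal _ (by linarith)]
    exact h1.eq_of_frequently_eq h2 hfr
  rw [hfe, congrFun hconj s, RCLike.norm_conj]

end

section

open Complex Filter Topology MeasureTheory Set

theorem conj_Gammaℝ_ofReal (x : ℝ) : (starRingEnd ℂ) (Gammaℝ x) = Gammaℝ x := by
  have e : Gammaℝ x = ((Real.pi ^ (-x / 2) * Real.Gamma (x / 2) : ℝ) : ℂ) := by
    rw [Gammaℝ_def]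
    push_cast
    rw [ofReal_cpow Real.pi_pos.le, ← Gamma_ofReal]
    push_cast
    rfl
  rw [e, conj_ofReal]

theorem conj_LSeries_ofReal {g : ℕ → ℂ} (hg : ∀ n, (starRingEnd ℂ) (g n) = g n) (x : ℝ) :
    (starRingEnd ℂ) (LSeries g x) = LSeries g x := by
  rw [LSeries, Complex.conj_tsum]
  refine tsum_congr fun n => ?_
  rcases Nat.eq_zero_or_pos n with rfl | hn
  · simp
  rw [LSeries.term_of_ne_zero hn.ne', map_div₀, hg]
  congr 1
  rw [← ofReal_natCast, ← ofReal_cpow (Nat.cast_nonneg n), conj_ofReal]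

/-- The entire function `s (s - 1) Λ(s)`. -/
noncomputable def xiZeta (s : ℂ) : ℂ := s * (s - 1) * completedRiemannZeta₀ s + 1

theorem xiZeta_eq {s : ℂ} (hs : 0 < s.re) (h1 : s ≠ 1) :
    xiZeta s = s * (s - 1) * Gammaℝ s * riemannZeta s := by
  have h0 : s ≠ 0 := by rintro rfl; simp at hs
  rw [riemannZeta_def_of_ne_zero h0, mul_assoc, mul_div_cancel₀ _ (Gammaℝ_ne_zero_of_re_pos hs),
    completedRiemannZeta_eq, xiZeta]
  have : 1 - s ≠ 0 := sub_ne_zero.mpr h1.symm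
  field_simp
  ring

theorem differentiable_xiZeta : Differentiable ℂ xiZeta := by
  have := differentiable_completedZeta₀
  unfold xiZeta
  fun_prop

theorem xiLike_xiZeta (herh : ERH) : XiLike xiZeta := by
  have hfe : ∀ s, ‖xiZeta (1 - s)‖ = ‖xiZeta s‖ := fun s => by
    rw [xiZeta, xiZeta, completedRiemannZeta₀_one_sub]
    congr 3
    ring
  have eqL : ∀ s : ℂ, 1 < s.re → riemannZeta s = LSeries 1 s := fun s hs =>
    (LSeries_one_eq_riemannZeta hs).symm
  have ne1 : ∀ s : ℂ, 1 < s.re → s ≠ 1 := by rintro s hs rfl; simp at hs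
  refine XiLike.of_eq_mul (A := fun s => s * (s - 1)) (f := riemannZeta) (g := 1) (δ := 0) le_rfl
    differentiable_xiZeta (norm_one_sub_conj_eq differentiable_xiZeta (fun x hx => ?_) hfe)
    (fun s hs => ?_) ?_ (fun s hs => ?_) (fun s hs => eqL s (by linarith)) rfl (by simp)
    (fun s hs => ?_) (fun s hs h hh hh1 => ?_)
  · have hx' : 1 < (x : ℂ).re := by simpa
    rw [xiZeta_eq (by linarith) (ne1 _ hx'), eqL _ hx', map_mul, map_mul, conj_Gammaℝ_ofReal,
      conj_LSeries_ofReal (fun n => by simp)]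
    simp
  · rcases eq_or_ne s 1 with rfl | h1
    · simp [xiZeta]
    have h0 : s ≠ 0 := by rintro rfl; simp at hs; linarith
    rw [xiZeta_eq (by linarith) h1]
    have hz : riemannZeta s ≠ 0 := by
      rcases lt_or_ge s.re 1 with h | h
      · have := herh 1 1 s hs h
        rwa [DirichletCharacter.LFunction_modOne_eq] at this
      · exact riemannZeta_ne_zero_of_one_le_re h
    exact mul_ne_zero (mul_ne_zero (mul_ne_zero h0 (sub_ne_zero.mpr h1))
      (Gammaℝ_ne_zero_of_re_pos (by linarith))) hz
  · exact ((ExpBounded.id.mul (ExpBounded.id.add (.const (-1)))).mul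
      (expBounded_completedHurwitzZetaEven₀ 0)).add (.const 1)
  · rw [xiZeta_eq (by linarith) (ne1 _ (by linarith))]
    simp
  · have h1 := (le_abs_self _).trans (abs_re_le_norm s)
    have h2 := (le_abs_self _).trans (abs_re_le_norm (s - 1))
    rw [norm_mul]
    simp only [sub_re, one_re] at h2
    nlinarith
  · rw [norm_mul, norm_mul]
    have key : ∀ w : ℂ, 1 ≤ w.re → ‖w - h‖ ≤ ‖w‖ := fun w hw => by
      rw [norm_def, norm_def]
      refine Real.sqrt_le_sqrt ?_
      simp only [normSq_apply, sub_re, sub_im, ofReal_re, ofReal_im]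
      nlinarith
    have e : s - h - 1 = s - 1 - h := by ring
    rw [e]
    exact mul_le_mul (key s (by linarith)) (key (s - 1) (by simp; linarith)) (norm_nonneg _)
      (norm_nonneg _)

/-- The completed L-function normalised so that its modulus is symmetric about `1/2`. -/
noncomputable def xiChar {N : ℕ} [NeZero N] (χ : DirichletCharacter ℂ N) (s : ℂ) : ℂ :=
  (N : ℂ) ^ (s / 2) * χ.completedLFunction s

/-- `0` for even characters and `1` for odd ones. -/
noncomputable def parity {N : ℕ} (χ : DirichletCharacter ℂ N) : ℝ :=
  open scoped Classical in if χ.Even then 0 else 1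

theorem parity_eq_zero_or_one {N : ℕ} (χ : DirichletCharacter ℂ N) :
    parity χ = 0 ∨ parity χ = 1 := by
  unfold parity
  split_ifs <;> simp

theorem gammaFactor_eq {N : ℕ} (χ : DirichletCharacter ℂ N) (s : ℂ) :
    χ.gammaFactor s = Gammaℝ (s + parity χ) := by
  unfold parity DirichletCharacter.gammaFactor
  split_ifs <;> simp

theorem xiChar_eq {N : ℕ} [NeZero N] {χ : DirichletCharacter ℂ N} {s : ℂ} (hs : 0 < s.re) :
    xiChar χ s = (N : ℂ) ^ (s / 2) * Gammaℝ (s + parity χ) * χ.LFunction s := by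
  have h0 : s ≠ 0 := by rintro rfl; simp at hs
  have hp : 0 ≤ parity χ := by rcases parity_eq_zero_or_one χ with h | h <;> simp [h]
  rw [χ.LFunction_eq_completed_div_gammaFactor s (Or.inl h0), gammaFactor_eq, mul_assoc,
    mul_div_cancel₀ _ (Gammaℝ_ne_zero_of_re_pos (by simp; linarith)), xiChar]

theorem differentiable_xiChar {N : ℕ} [NeZero N] {χ : DirichletCharacter ℂ N} (h1 : χ ≠ 1) :
    Differentiable ℂ (xiChar χ) := by
  have := DirichletCharacter.differentiable_completedLFunction h1
  unfold xiChar
  refine Differentiable.mul (fun s => ?_) this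
  exact DifferentiableAt.const_cpow (by fun_prop) (Or.inl (NeZero.ne _))

theorem xiLike_xiChar (herh : ERH) {N : ℕ} [NeZero N] {χ : DirichletCharacter ℂ N} (h1 : χ ≠ 1)
    (hprim : χ.IsPrimitive) (hreal : ∀ a, (starRingEnd ℂ) (χ a) = χ a) : XiLike (xiChar χ) := by
  have hinv : χ⁻¹ = χ := by
    rw [← MulChar.star_eq_inv]
    ext a
    rw [MulChar.star_apply]
    exact hreal a
  have hNpos : 0 < N := Nat.pos_of_ne_zero (NeZero.ne N)
  have hN1 : (1 : ℝ) ≤ N := by exact_mod_cast hNpos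
  have hp : 0 ≤ parity χ := by rcases parity_eq_zero_or_one χ with h | h <;> simp [h]
  have hne : ∀ s : ℂ, 1 / 2 < s.re → xiChar χ s ≠ 0 := fun s hs => by
    rw [xiChar_eq (by linarith)]
    have hz : χ.LFunction s ≠ 0 := by
      rcases lt_or_ge s.re 1 with h | h
      · exact herh N χ s hs h
      · exact χ.LFunction_ne_zero_of_one_le_re (Or.inl h1) h
    refine mul_ne_zero (mul_ne_zero ?_ (Gammaℝ_ne_zero_of_re_pos (by simp; linarith))) hz
    simp [cpow_eq_zero_iff, NeZero.ne N]
  have hfe' : ∀ s, ‖xiChar χ (1 - s)‖ = ‖χ.rootNumber‖ * ‖xiChar χ s‖ := fun s => by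
    rw [xiChar, xiChar, hprim.completedLFunction_one_sub, hinv]
    simp only [norm_mul, norm_natCast_cpow_of_pos hNpos]
    have e : (N : ℝ) ^ (s / 2).re = (N : ℝ) ^ ((1 - s) / 2).re * (N : ℝ) ^ (s - 1 / 2).re := by
      rw [← Real.rpow_add (by positivity)]
      congr 1
      simp
      ring
    rw [e]
    ring
  have hroot : ‖χ.rootNumber‖ = 1 := by
    have e1 := hfe' 2
    have e2 := hfe' (1 - 2)
    rw [sub_sub_cancel, e1, ← mul_assoc] at e2
    have h2 : 0 < ‖xiChar χ 2‖ := norm_pos_iff.mpr (hne 2 (by norm_num))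
    have h3 := norm_nonneg χ.rootNumber
    have h4 : ‖χ.rootNumber‖ * ‖χ.rootNumber‖ = 1 := by
      refine mul_right_cancel₀ h2.ne' ?_
      rw [one_mul]
      exact e2.symm
    nlinarith
  have hfe : ∀ s, ‖xiChar χ (1 - s)‖ = ‖xiChar χ s‖ := fun s => by rw [hfe', hroot, one_mul]
  have eqL : ∀ s : ℂ, 1 < s.re → χ.LFunction s = LSeries (fun n : ℕ => χ n) s := fun s hs =>
    χ.LFunction_eq_LSeries hs
  refine XiLike.of_eq_mul (A := fun s => (N : ℂ) ^ (s / 2)) (f := χ.LFunction)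
    (g := fun n : ℕ => χ n) (δ := parity χ) hp (differentiable_xiChar h1)
    (norm_one_sub_conj_eq (differentiable_xiChar h1) (fun x hx => ?_) hfe) hne ?_
    (fun s hs => xiChar_eq (by linarith)) (fun s hs => eqL s (by linarith)) (by simp)
    (fun n => χ.norm_le_one _) (fun s hs => ?_) (fun s hs h hh hh1 => ?_)
  · have hx' : 1 < (x : ℂ).re := by simpa
    rw [xiChar_eq (by linarith), eqL _ hx', map_mul, map_mul, ← ofReal_add, conj_Gammaℝ_ofReal,
      conj_LSeries_ofReal (fun n => hreal n)]
    congr 2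
    have : ((N : ℂ) ^ ((x : ℂ) / 2)) = (((N : ℝ) ^ (x / 2) : ℝ) : ℂ) := by
      rw [ofReal_cpow (by positivity)]
      push_cast
      rfl
    rw [this, conj_ofReal]
  · have hN : ExpBounded (fun s => (N : ℂ) ^ (s / 2)) := by
      have := ExpBounded.cpow (NeZero.ne N) (1 / 2)
      refine (funext fun s => ?_ : (fun s => (N : ℂ) ^ (((1 / 2 : ℝ) : ℂ) * s)) =
        fun s => (N : ℂ) ^ (s / 2)) ▸ this
      congr 1
      push_cast
      ring
    refine hN.mul (ZMod.expBounded_completedLFunction ?_ (χ.sum_eq_zero_of_ne_one h1))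
    exact χ.map_zero' (h1 ∘ DirichletCharacter.level_one' _)
  · rw [norm_natCast_cpow_of_pos hNpos]
    exact Real.one_le_rpow hN1 (by simp; linarith)
  · simp only [norm_natCast_cpow_of_pos hNpos]
    exact Real.rpow_le_rpow_of_exponent_le hN1 (by simp; linarith)

end

section

open MeasureTheory Set Filter Topology

/-- The Laplace original of `s ↦ (1 + s)⁻²`, extended by zero to the negative axis. -/
noncomputable def rampExp (u : ℝ) : ℝ := max u 0 * Real.exp (-u)

theorem rampExp_nonneg (u : ℝ) : 0 ≤ rampExp u :=
  mul_nonneg (le_max_right _ _) (Real.exp_pos _).le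

theorem rampExp_of_nonpos {u : ℝ} (hu : u ≤ 0) : rampExp u = 0 := by
  simp [rampExp, max_eq_right hu]

theorem rampExp_of_nonneg {u : ℝ} (hu : 0 ≤ u) : rampExp u = u * Real.exp (-u) := by
  rw [rampExp, max_eq_left hu]

theorem continuous_rampExp : Continuous rampExp := by
  unfold rampExp
  fun_prop

theorem rampExp_laplace {s c : ℝ} (hs : 0 < s) (hc : 0 ≤ c) :
    IntegrableOn (fun t => Real.exp (-(s * t)) * rampExp (t - c)) (Ioi 0) ∧
    ∫ t in Ioi 0, Real.exp (-(s * t)) * rampExp (t - c) = Real.exp (-(s * c)) / (1 + s) ^ 2 := by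
  set g : ℝ → ℝ := fun u => Real.exp (-(s * c)) * (Real.exp (-(s * u)) * rampExp u) with hg
  have hgI : EqOn g (fun u => Real.exp (-(s * c)) * (u * Real.exp (-((1 + s) * u)))) (Ioi 0) := by
    intro u (hu : 0 < u)
    have : Real.exp (-((1 + s) * u)) = Real.exp (-(s * u)) * Real.exp (-u) := by
      rw [← Real.exp_add]; ring_nf
    simp only [hg, rampExp_of_nonneg hu.le, this]
    ring
  have hg0 : ∀ u, u ∉ Ioi (0:ℝ) → g u = 0 := fun u hu => by
    simp only [mem_Ioi, not_lt] at hu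
    simp [hg, rampExp_of_nonpos hu]
  have hgint : Integrable g := by
    rw [← integrableOn_iff_integrable_of_support_subset (s := Ioi 0)]
    · have h := Integrable.const_mul (integrableOn_mul_exp_neg_mul (show 0 < 1 + s by linarith))
        (Real.exp (-(s * c)))
      exact IntegrableOn.congr_fun h (fun u hu => (hgI hu).symm) measurableSet_Ioi
    · intro u hu
      by_contra h
      exact hu (hg0 u h)
  have hgv : ∫ u, g u = Real.exp (-(s * c)) / (1 + s) ^ 2 := by
    rw [← setIntegral_eq_integral_of_forall_compl_eq_zero hg0,
      setIntegral_congr_fun measurableSet_Ioi hgI, integral_const_mul,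
      integral_mul_exp_neg_mul (by linarith), mul_one_div]
  have e : (fun t => Real.exp (-(s * t)) * rampExp (t - c)) = fun t => g (t - c) := by
    funext t
    simp only [hg]
    rw [← mul_assoc, ← Real.exp_add]
    ring_nf
  rw [e]
  refine ⟨(hgint.comp_sub_right c).integrableOn, ?_⟩
  rw [setIntegral_eq_integral_of_forall_compl_eq_zero, integral_sub_right_eq_self, hgv]
  intro t ht
  simp only [mem_Ioi, not_lt] at ht
  exact hg0 _ (by simp; linarith)

/-- The Laplace original of `s ↦ 1 / ((s - α) (1 + s)²)`. -/
noncomputable def poleOriginal (α t : ℝ) : ℝ :=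
  (Real.exp (α * t) - Real.exp (-t) * (1 + (1 + α) * t)) / (1 + α) ^ 2

theorem poleOriginal_laplace {s α : ℝ} (hα : α ≠ -1) (hs : 0 < s) (hsα : α < s) :
    IntegrableOn (fun t => Real.exp (-(s * t)) * poleOriginal α t) (Ioi 0) ∧
    ∫ t in Ioi 0, Real.exp (-(s * t)) * poleOriginal α t = 1 / ((s - α) * (1 + s) ^ 2) := by
  have h1 : 1 + α ≠ 0 := fun h => hα (by linarith)
  have i1 := (integrableOn_exp_neg_mul (sub_pos.mpr hsα)).const_mul (1 / (1 + α) ^ 2)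
  have i2 := (integrableOn_exp_neg_mul (show 0 < 1 + s by linarith)).const_mul (1 / (1 + α) ^ 2)
  have i3 := (integrableOn_mul_exp_neg_mul (show 0 < 1 + s by linarith)).const_mul (1 / (1 + α))
  have e : (fun t => Real.exp (-(s * t)) * poleOriginal α t) = fun t =>
      1 / (1 + α) ^ 2 * Real.exp (-((s - α) * t)) - 1 / (1 + α) ^ 2 * Real.exp (-((1 + s) * t)) -
        1 / (1 + α) * (t * Real.exp (-((1 + s) * t))) := by
    funext t
    have e1 : Real.exp (-((1 + s) * t)) = Real.exp (-(s * t)) * Real.exp (-t) := by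
      rw [← Real.exp_add]; ring_nf
    have e2 : Real.exp (-((s - α) * t)) = Real.exp (-(s * t)) * Real.exp (α * t) := by
      rw [← Real.exp_add]; ring_nf
    rw [e1, e2, poleOriginal]
    field_simp
    ring
  rw [e]
  have i12 : IntegrableOn (fun t => 1 / (1 + α) ^ 2 * Real.exp (-((s - α) * t)) -
      1 / (1 + α) ^ 2 * Real.exp (-((1 + s) * t))) (Ioi 0) := i1.sub i2
  refine ⟨i12.sub i3, ?_⟩
  have h2 : s - α ≠ 0 := (sub_pos.mpr hsα).ne'
  have h3 : 1 + s ≠ 0 := by positivity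
  rw [integral_sub i12 i3, integral_sub i1 i2, integral_const_mul, integral_const_mul,
    integral_const_mul, integral_exp_neg_mul (sub_pos.mpr hsα), integral_exp_neg_mul (by linarith),
    integral_mul_exp_neg_mul (by linarith)]
  field_simp
  ring

/-- The Laplace original of `s ↦ (∑ bₙ n⁻ˢ) / (1 + s)²`. -/
noncomputable def dirichletOriginal (b : ℕ → ℝ) (t : ℝ) : ℝ :=
  ∑' n : ℕ, b n * rampExp (t - Real.log n)

theorem dirichletOriginal_eq_sum {b : ℕ → ℝ} (hb0 : b 0 = 0) {t : ℝ} {N : ℕ}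
    (hN : Real.exp t ≤ N) :
    dirichletOriginal b t = ∑ n ∈ Finset.range N, b n * rampExp (t - Real.log n) := by
  refine tsum_eq_sum fun n hn => ?_
  rcases Nat.eq_zero_or_pos n with rfl | hpos
  · simp [hb0]
  have : (N : ℝ) ≤ n := by exact_mod_cast Finset.mem_range.not.mp hn |> not_lt.mp
  have h2 : t ≤ Real.log n := (Real.le_log_iff_exp_le (by exact_mod_cast hpos)).mpr (by linarith)
  rw [rampExp_of_nonpos (by linarith), mul_zero]

theorem continuous_dirichletOriginal {b : ℕ → ℝ} (hb0 : b 0 = 0) :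
    Continuous (dirichletOriginal b) := by
  refine continuous_iff_continuousAt.mpr fun t₀ => ?_
  obtain ⟨N, hN⟩ := exists_nat_ge (Real.exp (t₀ + 1))
  have h : dirichletOriginal b =ᶠ[𝓝 t₀] fun t =>
      ∑ n ∈ Finset.range N, b n * rampExp (t - Real.log n) := by
    filter_upwards [Iio_mem_nhds (show t₀ < t₀ + 1 by linarith)] with t ht
    exact dirichletOriginal_eq_sum hb0 ((Real.exp_le_exp.mpr (le_of_lt ht)).trans hN)
  refine ContinuousAt.congr ?_ h.symm
  refine Continuous.continuousAt (continuous_finsetSum _ fun n _ => ?_)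
  exact continuous_const.mul (continuous_rampExp.comp (continuous_id.sub continuous_const))

theorem dirichletOriginal_laplace {b : ℕ → ℝ} (hb : ∀ n, 0 ≤ b n) {s : ℝ}
    (hs : 0 < s) (hsum : Summable fun n : ℕ => b n * Real.exp (-(s * Real.log n))) :
    IntegrableOn (fun t => Real.exp (-(s * t)) * dirichletOriginal b t) (Ioi 0) ∧
    ∫ t in Ioi 0, Real.exp (-(s * t)) * dirichletOriginal b t =
      (∑' n : ℕ, b n * Real.exp (-(s * Real.log n))) / (1 + s) ^ 2 := by
  have hF := fun n : ℕ => rampExp_laplace hs (Real.log_natCast_nonneg n)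
  have e : (fun t => Real.exp (-(s * t)) * dirichletOriginal b t) = fun t =>
      ∑' n : ℕ, b n * (Real.exp (-(s * t)) * rampExp (t - Real.log n)) := by
    funext t
    rw [dirichletOriginal, ← tsum_mul_left]
    exact tsum_congr fun n => by ring
  have hval : ∀ n : ℕ, ∫ t in Ioi 0, b n * (Real.exp (-(s * t)) * rampExp (t - Real.log n)) =
      b n * Real.exp (-(s * Real.log n)) / (1 + s) ^ 2 := fun n => by
    rw [integral_const_mul, (hF n).2, mul_div_assoc]
  have hnorm : ∀ n : ℕ, ∀ t, ‖b n * (Real.exp (-(s * t)) * rampExp (t - Real.log n))‖ =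
      b n * (Real.exp (-(s * t)) * rampExp (t - Real.log n)) := fun n t =>
    Real.norm_of_nonneg (mul_nonneg (hb n) (mul_nonneg (Real.exp_pos _).le (rampExp_nonneg _)))
  have hH := hasSum_integral_of_summable_integral_norm (μ := volume.restrict (Ioi 0))
    (F := fun (n : ℕ) t => b n * (Real.exp (-(s * t)) * rampExp (t - Real.log n)))
    (fun n => (hF n).1.const_mul (b n)) (by
      simp only [hnorm, hval]
      exact hsum.div_const _)
  simp only [hval] at hH
  have hv : ∫ t in Ioi 0, Real.exp (-(s * t)) * dirichletOriginal b t =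
      (∑' n : ℕ, b n * Real.exp (-(s * Real.log n))) / (1 + s) ^ 2 := by
    rw [e, ← hH.tsum_eq, tsum_div_const]
  refine ⟨?_, hv⟩
  by_cases h0 : ∀ n, b n = 0
  · have : (fun t => Real.exp (-(s * t)) * dirichletOriginal b t) = fun _ => 0 := by
      funext t
      simp [dirichletOriginal, h0]
    rw [this]
    exact integrableOn_zero
  · push Not at h0
    obtain ⟨m, hm⟩ := h0
    refine Integrable.of_integral_ne_zero ?_
    rw [hv]
    have : 0 < ∑' n : ℕ, b n * Real.exp (-(s * Real.log n)) :=
      hsum.tsum_pos (fun n => mul_nonneg (hb n) (Real.exp_pos _).le) m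
        (mul_pos (lt_of_le_of_ne (hb m) hm.symm) (Real.exp_pos _))
    positivity

theorem dirichlet_explicit_le {F H : ℂ → ℂ} (hF : DifferentiableOn ℂ F {w | 0 < w.re})
    (hFpos : ∀ w, 0 < w.re → 0 ≤ (F w).re) (hH : DifferentiableOn ℂ H {w | 0 < w.re})
    (hHpos : ∀ w, 0 < w.re → 0 ≤ (H w).re) {b : ℕ → ℝ} (hb0 : b 0 = 0) (hb : ∀ n, 0 ≤ b n)
    (hsum : ∀ s : ℝ, 1 ≤ s → Summable fun n : ℕ => b n * Real.exp (-(s * Real.log n))) {K L : ℝ}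
    (hL : 0 < L)
    (hFH : ∀ s : ℝ, 1 ≤ s → (F s).re - (H s).re = 1 / (s + 1 / 2) + 1 / (s - 1 / 2) + K -
      ∑' n : ℕ, b n * Real.exp (-(s * Real.log n))) :
    poleOriginal (1 / 2) L + poleOriginal (-1 / 2) L + K * (L * Real.exp (-L)) -
      dirichletOriginal b L ≤ (2 * (H 1).re + 8 / 3 + K) * (1 + (1 + L) * Real.exp (-L)) := by
  set a : ℝ → ℝ := fun t => poleOriginal (1 / 2) t + poleOriginal (-1 / 2) t +
    K * rampExp (t - 0) - dirichletOriginal b t with ha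
  have lap : ∀ s : ℝ, 1 ≤ s → IntegrableOn (fun t => Real.exp (-(s * t)) * a t) (Ioi 0) ∧
      ∫ t in Ioi 0, Real.exp (-(s * t)) * a t = ((F s).re - (H s).re) / (1 + s) ^ 2 := by
    intro s hs
    obtain ⟨i1, v1⟩ := poleOriginal_laplace (s := s) (α := 1 / 2) (by norm_num) (by linarith)
      (by linarith)
    obtain ⟨i2, v2⟩ := poleOriginal_laplace (s := s) (α := -1 / 2) (by norm_num) (by linarith)
      (by linarith)
    obtain ⟨i3, v3⟩ := rampExp_laplace (s := s) (c := 0) (by linarith) le_rfl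
    obtain ⟨i4, v4⟩ := dirichletOriginal_laplace hb (show 0 < s by linarith) (hsum s hs)
    have e : (fun t => Real.exp (-(s * t)) * a t) = fun t =>
        Real.exp (-(s * t)) * poleOriginal (1 / 2) t +
        Real.exp (-(s * t)) * poleOriginal (-1 / 2) t +
        K * (Real.exp (-(s * t)) * rampExp (t - 0)) -
        Real.exp (-(s * t)) * dirichletOriginal b t := by
      funext t
      simp only [ha]
      ring
    rw [e]
    have i12 : IntegrableOn (fun t => Real.exp (-(s * t)) * poleOriginal (1 / 2) t +
        Real.exp (-(s * t)) * poleOriginal (-1 / 2) t) (Ioi 0) := i1.add i2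
    have i123 : IntegrableOn (fun t => Real.exp (-(s * t)) * poleOriginal (1 / 2) t +
        Real.exp (-(s * t)) * poleOriginal (-1 / 2) t +
        K * (Real.exp (-(s * t)) * rampExp (t - 0))) (Ioi 0) := i12.add (i3.const_mul K)
    refine ⟨i123.sub i4, ?_⟩
    rw [integral_sub i123 i4, integral_add i12 (i3.const_mul K), integral_add i1 i2, integral_const_mul, v1, v2, v3, v4, hFH s hs]
    have h1 : s - 1 / 2 ≠ 0 := by linarith
    have h2 : s + 1 / 2 ≠ 0 := by linarith
    have h3 : s - -1 / 2 ≠ 0 := by linarith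
    have h4 : (1 + s) ^ 2 ≠ 0 := by positivity
    have h5 : s - -1 / 2 = s + 1 / 2 := by ring
    rw [h5, mul_zero, neg_zero, Real.exp_zero]
    field_simp
    ring
  have hac : Continuous a := by
    have := continuous_dirichletOriginal hb0
    have := continuous_rampExp
    simp only [ha, poleOriginal]
    fun_prop
  have hmain := le_of_laplace_eq hF hFpos hH hHpos one_pos hL (lap 1 le_rfl).1 hac.continuousAt
    (fun s hs => (lap s hs).2)
  have h1 := hFH 1 le_rfl
  norm_num at h1
  have hS : 0 ≤ ∑' n : ℕ, b n * Real.exp (-Real.log n) :=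
    tsum_nonneg fun n => mul_nonneg (hb n) (Real.exp_pos _).le
  have haL : a L = poleOriginal (1 / 2) L + poleOriginal (-1 / 2) L + K * (L * Real.exp (-L)) -
      dirichletOriginal b L := by
    simp only [ha, sub_zero, rampExp_of_nonneg hL.le]
  rw [← haL]
  refine hmain.trans (mul_le_mul_of_nonneg_right ?_ ?_)
  · linarith
  · have := mul_pos (show 0 < 1 + L by linarith) (Real.exp_pos (-L))
    linarith

end

section

open Complex Filter Topology Set ArithmeticFunction

theorem differentiableOn_logDeriv_of_ne_zero {G : ℂ → ℂ} {U : Set ℂ} (hU : IsOpen U)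
    (hG : DifferentiableOn ℂ G U) (h0 : ∀ s ∈ U, G s ≠ 0) : DifferentiableOn ℂ (logDeriv G) U :=
  (hG.deriv hU).div hG h0

theorem differentiableOn_digamma : DifferentiableOn ℂ digamma {z | 0 < z.re} := by
  rw [digamma_def]
  exact differentiableOn_logDeriv_of_ne_zero (isOpen_lt continuous_const continuous_re)
    (fun z hz => (differentiableAt_Gamma_of_re_pos hz).differentiableWithinAt)
    (fun z hz => Gamma_ne_zero_of_re_pos hz)

theorem hasDerivAt_Gammaℝ {s : ℂ} (hs : 0 < s.re) :
    HasDerivAt Gammaℝ (Gammaℝ s * (-(Real.log Real.pi : ℂ) / 2 + digamma (s / 2) / 2)) s := by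
  have hs2 : 0 < (s / 2).re := by simpa
  have hpi : (Real.pi : ℂ) ≠ 0 := ofReal_ne_zero.mpr Real.pi_ne_zero
  have h1 : HasDerivAt (fun s : ℂ => (Real.pi : ℂ) ^ (-s / 2)) _ s :=
    HasDerivAt.const_cpow ((hasDerivAt_id s).neg.div_const 2) (Or.inl hpi)
  have h2 : HasDerivAt (fun s : ℂ => Gamma (s / 2)) _ s :=
    (differentiableAt_Gamma_of_re_pos hs2).hasDerivAt.comp s ((hasDerivAt_id s).div_const 2)
  have h3 : HasDerivAt Gammaℝ _ s := h1.mul h2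
  refine h3.congr_deriv ?_
  have h4 := Gamma_ne_zero_of_re_pos hs2
  rw [Gammaℝ_def, digamma_def, logDeriv_apply, ofReal_log Real.pi_pos.le]
  field_simp

theorem logDeriv_Gammaℝ {s : ℂ} (hs : 0 < s.re) :
    logDeriv Gammaℝ s = -(Real.log Real.pi : ℂ) / 2 + digamma (s / 2) / 2 := by
  rw [logDeriv_apply, (hasDerivAt_Gammaℝ hs).deriv, mul_div_cancel_left₀ _
    (Gammaℝ_ne_zero_of_re_pos hs)]

theorem logDeriv_xiZeta {s : ℂ} (hs : 1 < s.re) :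
    logDeriv xiZeta s = 1 / s + 1 / (s - 1) + (-(Real.log Real.pi : ℂ) / 2 + digamma (s / 2) / 2) -
      LSeries (fun n => (Λ n : ℂ)) s := by
  have ne1 : ∀ s : ℂ, 1 < s.re → s ≠ 1 := by rintro s hs rfl; simp at hs
  have h0 : s ≠ 0 := by rintro rfl; simp at hs; linarith
  have hs1 : s - 1 ≠ 0 := sub_ne_zero.mpr (ne1 s hs)
  have hev : xiZeta =ᶠ[𝓝 s] fun s => s * (s - 1) * Gammaℝ s * riemannZeta s := by
    filter_upwards [(isOpen_lt continuous_const continuous_re).mem_nhds hs] with z hz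
    exact xiZeta_eq (by have : 1 < z.re := hz; linarith) (ne1 z hz)
  have hG := Gammaℝ_ne_zero_of_re_pos (show 0 < s.re by linarith)
  have hz := riemannZeta_ne_zero_of_one_le_re hs.le
  rw [LSeries_vonMangoldt_eq_deriv_riemannZeta_div hs, ← logDeriv_Gammaℝ (by linarith),
    logDeriv_apply, logDeriv_apply, hev.deriv_eq, hev.eq_of_nhds]
  have d1 : HasDerivAt (fun s : ℂ => s * (s - 1)) (1 * (s - 1) + s * 1) s :=
    (hasDerivAt_id s).mul ((hasDerivAt_id s).sub_const 1)
  have d2 := (d1.mul (hasDerivAt_Gammaℝ (show 0 < s.re by linarith)).differentiableAt.hasDerivAt).mul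
    (differentiableAt_riemannZeta (ne1 s hs)).hasDerivAt
  have d3 : deriv (fun s => s * (s - 1) * Gammaℝ s * riemannZeta s) s = _ := d2.deriv
  rw [d3]
  simp only [Pi.mul_apply]
  field_simp
  ring

theorem logDeriv_xiChar {N : ℕ} [NeZero N] {χ : DirichletCharacter ℂ N} (h1 : χ ≠ 1) {s : ℂ}
    (hs : 1 < s.re) :
    logDeriv (xiChar χ) s = (Real.log N : ℂ) / 2 +
      (-(Real.log Real.pi : ℂ) / 2 + digamma ((s + parity χ) / 2) / 2) -
      LSeries ((fun n : ℕ => χ n) * fun n => (Λ n : ℂ)) s := by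
  have hp : 0 ≤ parity χ := by rcases parity_eq_zero_or_one χ with h | h <;> simp [h]
  have hsp : 0 < (s + parity χ).re := by simp; linarith
  have hN0 : (N : ℂ) ≠ 0 := NeZero.ne _
  have hev : xiChar χ =ᶠ[𝓝 s] fun s =>
      (N : ℂ) ^ (s / 2) * Gammaℝ (s + parity χ) * χ.LFunction s := by
    filter_upwards [(isOpen_lt continuous_const continuous_re).mem_nhds hs] with z hz
    exact xiChar_eq (by have : 1 < z.re := hz; linarith)
  have hG := Gammaℝ_ne_zero_of_re_pos hsp
  have hz := χ.LFunction_ne_zero_of_one_le_re (Or.inl h1) hs.le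
  have hNs : (N : ℂ) ^ (s / 2) ≠ 0 := by simp [cpow_eq_zero_iff, NeZero.ne N]
  have e := DirichletCharacter.LSeries_twist_vonMangoldt_eq χ hs
  rw [← χ.deriv_LFunction_eq_deriv_LSeries hs, ← χ.LFunction_eq_LSeries hs] at e
  rw [e, logDeriv_apply, hev.deriv_eq, hev.eq_of_nhds]
  have d1 : HasDerivAt (fun s : ℂ => (N : ℂ) ^ (s / 2)) _ s :=
    HasDerivAt.const_cpow ((hasDerivAt_id s).div_const 2) (Or.inl hN0)
  have d0 : HasDerivAt (fun s : ℂ => Gammaℝ (s + parity χ)) _ s :=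
    (hasDerivAt_Gammaℝ hsp).comp_add_const s _
  have d2 := (d1.mul d0).mul (χ.differentiable_LFunction h1 s).hasDerivAt
  have d3 : deriv (fun s => (N : ℂ) ^ (s / 2) * Gammaℝ (s + parity χ) * χ.LFunction s) s = _ :=
    d2.deriv
  rw [d3, natCast_log]
  simp only [Pi.mul_apply]
  field_simp
  ring

theorem term_re_eq {χ : ℕ → ℂ} {s : ℝ} (n : ℕ) :
    (LSeries.term (fun n => (Λ n : ℂ)) (1 / 2 + s) n +
      LSeries.term (χ * fun n => (Λ n : ℂ)) (1 / 2 + s) n).re =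
      Λ n * (1 + (χ n).re) / √n * Real.exp (-(s * Real.log n)) := by
  rcases Nat.eq_zero_or_pos n with rfl | hn
  · simp
  rw [LSeries.term_of_ne_zero hn.ne', LSeries.term_of_ne_zero hn.ne', ← add_div]
  have hn' : (0 : ℝ) < n := by exact_mod_cast hn
  have e : (n : ℂ) ^ (1 / 2 + s : ℂ) = ((√n * Real.exp (s * Real.log n) : ℝ) : ℂ) := by
    rw [mul_comm s, ← Real.rpow_def_of_pos hn', Real.sqrt_eq_rpow, ← Real.rpow_add hn',
      ofReal_cpow hn'.le]
    push_cast
    rfl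
  rw [e, div_ofReal_re]
  simp only [Pi.mul_apply, add_re, ofReal_re, mul_re, ofReal_im, mul_zero, sub_zero]
  rw [Real.exp_neg]
  have := (Real.exp_pos (s * Real.log n)).ne'
  have := (Real.sqrt_pos.mpr hn').ne'
  field_simp

/-- Minus half the sum of the digamma values at the centre of the critical strip. -/
noncomputable def gammaConst (δ : ℝ) : ℝ := -(rdigamma (1 / 4) + rdigamma ((1 / 2 + δ) / 2)) / 2

theorem explicit_le_of_ERH (herh : ERH) {f : ℕ} [NeZero f] {χ : DirichletCharacter ℂ f}
    (h1 : χ ≠ 1) (hprim : χ.IsPrimitive) (hreal : ∀ a, (starRingEnd ℂ) (χ a) = χ a)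
    {L : ℝ} (hL : 0 < L) :
    poleOriginal (1 / 2) L + poleOriginal (-1 / 2) L +
      (Real.log f / 2 - Real.log Real.pi - gammaConst (parity χ)) * (L * Real.exp (-L)) -
      dirichletOriginal (fun n => Λ n * (1 + (χ n).re) / √n) L ≤
    (8 / 3 + Real.log f / 2 - Real.log Real.pi + gammaConst (parity χ) + rdigamma (3 / 4) +
      rdigamma ((3 / 2 + parity χ) / 2)) * (1 + (1 + L) * Real.exp (-L)) := by
  set δ := parity χ with hδ
  have hp : 0 ≤ δ := by rcases parity_eq_zero_or_one χ with h | h <;> simp [hδ, h]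
  have hζ := xiLike_xiZeta herh
  have hχ := xiLike_xiChar herh h1 hprim hreal
  have hU : IsOpen {w : ℂ | 0 < w.re} := isOpen_lt continuous_const continuous_re
  have hV : IsOpen {w : ℂ | 1 / 2 < w.re} := isOpen_lt continuous_const continuous_re
  have hmaps : MapsTo (fun w : ℂ => 1 / 2 + w) {w | 0 < w.re} {w : ℂ | 1 / 2 < w.re} := by
    intro w (hw : 0 < w.re)
    simpa using hw
  have hdig : ∀ c : ℝ, 0 ≤ c →
      DifferentiableOn ℂ (fun w : ℂ => digamma ((1 / 2 + w + c) / 2)) {w : ℂ | 0 < w.re} := by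
    intro c hc
    refine differentiableOn_digamma.comp (t := {w : ℂ | 0 < w.re})
      (f := fun w : ℂ => (1 / 2 + w + c) / 2)
      (by fun_prop) ?_
    intro w (hw : 0 < w.re)
    simp
    positivity
  have hdig_re : ∀ c : ℝ, 0 ≤ c → ∀ w : ℂ, 0 < w.re →
      rdigamma ((1 / 2 + c) / 2) ≤ (digamma ((1 / 2 + w + c) / 2)).re := by
    intro c hc w hw
    have e : ((1 / 2 + w + c) / 2).re = (1 / 2 + w.re + c) / 2 := by simp
    have h := rdigamma_re_le (z := (1 / 2 + w + c) / 2) (by rw [e]; positivity)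
    rw [e] at h
    refine le_trans (rdigamma_monotoneOn ?_ ?_ ?_) h
    · simp only [Set.mem_Ioi]; positivity
    · simp only [Set.mem_Ioi]; positivity
    · linarith
  have key := dirichlet_explicit_le
    (F := fun w => logDeriv xiZeta (1 / 2 + w) + logDeriv (xiChar χ) (1 / 2 + w))
    (H := fun w => gammaConst δ + digamma ((1 / 2 + w + (0 : ℝ)) / 2) / 2 +
      digamma ((1 / 2 + w + δ) / 2) / 2)
    (b := fun n => Λ n * (1 + (χ n).re) / √n)
    (K := Real.log f / 2 - Real.log Real.pi - gammaConst δ) (L := L) ?_ ?_ ?_ ?_ ?_ ?_ ?_ hL ?_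
  · refine key.trans (le_of_eq ?_)
    congr 1
    have e1 : (1 / 2 + 1 + ((0 : ℝ) : ℂ)) / 2 = ((3 / 4 : ℝ) : ℂ) := by push_cast; norm_num
    have e2 : (1 / 2 + 1 + (δ : ℂ)) / 2 = (((3 / 2 + δ) / 2 : ℝ) : ℂ) := by push_cast; norm_num
    simp only [e1, e2, add_re, ofReal_re, div_ofNat_re]
    simp only [rdigamma]
    ring
  · exact ((differentiableOn_logDeriv_of_ne_zero hV hζ.diff.differentiableOn
      (fun s hs => hζ.ne_zero s hs)).comp (by fun_prop) hmaps).add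
      ((differentiableOn_logDeriv_of_ne_zero hV hχ.diff.differentiableOn
      (fun s hs => hχ.ne_zero s hs)).comp (by fun_prop) hmaps)
  · intro w hw
    have hw' : 1 / 2 < (1 / 2 + w).re := hmaps hw
    rw [add_re]
    exact add_nonneg (hζ.re_logDeriv_nonneg hw') (hχ.re_logDeriv_nonneg hw')
  · exact ((differentiableOn_const _).add ((hdig 0 le_rfl).div_const 2)).add
      ((hdig δ hp).div_const 2)
  · intro w hw
    have a1 := hdig_re 0 le_rfl w hw
    have a2 := hdig_re δ hp w hw
    have e : ((1 / 2 + 0) / 2 : ℝ) = 1 / 4 := by norm_num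
    rw [e] at a1
    simp only [add_re, ofReal_re, div_ofNat_re, gammaConst] at a1 a2 ⊢
    linarith
  · simp
  · intro n
    have h := (abs_le.mp ((abs_re_le_norm _).trans (χ.norm_le_one n))).1
    exact div_nonneg (mul_nonneg vonMangoldt_nonneg (by linarith)) (Real.sqrt_nonneg _)
  all_goals
    intro s hs
    have hs' : 1 < (1 / 2 + (s : ℂ)).re := by simp; linarith
    have S1 := LSeriesSummable_vonMangoldt hs'
    have S2 := DirichletCharacter.LSeriesSummable_twist_vonMangoldt χ hs'
    have S12 := Summable.add S1 S2
  · have := (hasSum_re S12.hasSum).summable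
    exact this.congr fun n => term_re_eq n
  · have e0 : (∑' n : ℕ, Λ n * (1 + (χ n).re) / √n * Real.exp (-(s * Real.log n))) =
        (LSeries (fun n => (Λ n : ℂ)) (1 / 2 + s)).re +
        (LSeries ((fun n : ℕ => χ n) * fun n => (Λ n : ℂ)) (1 / 2 + s)).re := by
      rw [← add_re, LSeries, LSeries, ← S1.tsum_add S2, re_tsum S12]
      exact tsum_congr fun n => (term_re_eq (χ := fun n : ℕ => χ n) n).symm
    rw [e0]
    simp only [logDeriv_xiZeta hs', logDeriv_xiChar h1 hs']
    have e1 : (1 / (1 / 2 + (s : ℂ))).re = 1 / (s + 1 / 2) := by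
      rw [show (1 / (1 / 2 + (s : ℂ))) = ((1 / (s + 1 / 2) : ℝ) : ℂ) by push_cast; ring, ofReal_re]
    have e2 : (1 / (1 / 2 + (s : ℂ) - 1)).re = 1 / (s - 1 / 2) := by
      rw [show (1 / (1 / 2 + (s : ℂ) - 1)) = ((1 / (s - 1 / 2) : ℝ) : ℂ) by push_cast; ring,
        ofReal_re]
    simp only [add_re, sub_re, e1, e2, neg_re, ofReal_re, div_ofNat_re, ofReal_zero, add_zero]
    ring

end

theorem sq_eq_trace_norm_of_basis {R S : Type*} [CommRing R] [CommRing S] [Algebra R S]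
    (b : Module.Basis (Fin 2) R S) (θ : S) :
    θ ^ 2 = Algebra.trace R S θ • θ - algebraMap R S (Algebra.norm R θ) := by
  apply Algebra.leftMulMatrix_injective b
  rw [map_sub, map_smul, map_pow, AlgHom.commutes, Algebra.trace_eq_matrix_trace b,
    Algebra.norm_eq_matrix_det b]
  set M := Algebra.leftMulMatrix b θ
  ext i j
  fin_cases i <;> fin_cases j <;>
    simp [pow_two, Matrix.mul_apply, Fin.sum_univ_two, Matrix.det_fin_two, Matrix.trace_fin_two,
      Matrix.algebraMap_matrix_apply] <;> ring

theorem discr_one_theta {R S : Type*} [CommRing R] [CommRing S] [Algebra R S] [Nontrivial R]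
    (b : Module.Basis (Fin 2) R S) (θ : S) :
    Algebra.discr R ![1, θ] = Algebra.trace R S θ ^ 2 - 4 * Algebra.norm R θ := by
  have h1 : Algebra.trace R S 1 = 2 := by
    rw [← map_one (algebraMap R S), Algebra.trace_algebraMap_of_basis b]
    simp
  have h2 : Algebra.trace R S (θ * θ) =
      Algebra.trace R S θ ^ 2 - 2 * Algebra.norm R θ := by
    rw [← pow_two, sq_eq_trace_norm_of_basis b, map_sub, map_smul,
      Algebra.trace_algebraMap_of_basis b]
    simp
    ring
  rw [Algebra.discr_def, Matrix.det_fin_two]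
  simp [Algebra.traceMatrix_apply, Algebra.traceForm_apply, h1, h2]
  ring

theorem exists_theta (K : Type) [Field K] [NumberField K] (hdeg : Module.finrank ℚ K = 2) :
    ∃ (θ : 𝓞 K) (t n : ℤ), θ ^ 2 = t * θ - n ∧ NumberField.discr K = t ^ 2 - 4 * n ∧
      ∀ x : 𝓞 K, ∃ a c : ℤ, x = a + c * θ := by
  have hr : Module.finrank ℤ (𝓞 K) = 2 := by rw [RingOfIntegers.rank, hdeg]
  let b : Module.Basis (Fin 2) ℤ (𝓞 K) := Module.finBasisOfFinrankEq ℤ (𝓞 K) hr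
  obtain ⟨a, c, h1⟩ : ∃ a c : ℤ, (1 : 𝓞 K) = a * b 0 + c * b 1 :=
    ⟨b.repr 1 0, b.repr 1 1, by
      conv_lhs => rw [← b.sum_repr 1]
      simp [Fin.sum_univ_two]⟩
  have hcop : IsCoprime a c := by
    rw [Int.isCoprime_iff_gcd_eq_one]
    obtain ⟨a', ha⟩ := Int.gcd_dvd_left a c
    obtain ⟨c', hc⟩ := Int.gcd_dvd_right a c
    have h : (1 : 𝓞 K) = algebraMap ℤ (𝓞 K) (Int.gcd a c) * (a' * b 0 + c' * b 1) := by
      have ha' := congrArg (Int.cast : ℤ → 𝓞 K) ha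
      have hc' := congrArg (Int.cast : ℤ → 𝓞 K) hc
      push_cast at ha' hc'
      rw [h1, ha', hc']
      simp
      ring
    have h2 := congrArg (Algebra.norm ℤ) h
    rw [map_one, map_mul, Algebra.norm_algebraMap_of_basis b] at h2
    have h3 : IsUnit ((Int.gcd a c : ℤ) ^ Fintype.card (Fin 2)) := IsUnit.of_mul_eq_one _ h2.symm
    rw [Fintype.card_fin] at h3
    have h4 := (isUnit_pow_iff two_ne_zero).mp h3
    exact Int.ofNat_isUnit.mp h4 |> Nat.isUnit_iff.mp
  obtain ⟨u, v, huv⟩ := hcop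
  have huv' : (u : 𝓞 K) * a + v * c = 1 := by exact_mod_cast congrArg (Int.cast : ℤ → 𝓞 K) huv
  set θ : 𝓞 K := -v * b 0 + u * b 1 with hθ
  have e0 : b 0 = u - c * θ := by
    rw [hθ]
    linear_combination (-b 0) * huv' - (u : 𝓞 K) * h1
  have e1 : b 1 = v + a * θ := by
    rw [hθ]
    linear_combination (-b 1) * huv' - (v : 𝓞 K) * h1
  have hd : NumberField.discr K = Algebra.discr ℤ ![1, θ] := by
    rw [← NumberField.discr_eq_discr K b]
    have hv : ![1, θ] = Matrix.vecMul b ((!![a, -v; c, u] : Matrix (Fin 2) (Fin 2) ℤ).map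
        (algebraMap ℤ (𝓞 K))) := by
      funext i
      fin_cases i
      · simp [Matrix.vecMul, dotProduct, Fin.sum_univ_two, h1]
        ring
      · simp [Matrix.vecMul, dotProduct, Fin.sum_univ_two, hθ]
        ring
    rw [hv, Algebra.discr_of_matrix_vecMul]
    have : (!![a, -v; c, u] : Matrix (Fin 2) (Fin 2) ℤ).det = 1 := by
      rw [Matrix.det_fin_two_of]
      linarith
    rw [this]
    ring
  refine ⟨θ, Algebra.trace ℤ (𝓞 K) θ, Algebra.norm ℤ θ, ?_, ?_, fun x => ?_⟩
  · have := sq_eq_trace_norm_of_basis b θ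
    simpa using this
  · rw [hd, discr_one_theta b]
  · refine ⟨b.repr x 0 * u + b.repr x 1 * v, -(b.repr x 0 * c) + b.repr x 1 * a, ?_⟩
    conv_lhs => rw [← b.sum_repr x]
    simp only [Fin.sum_univ_two, zsmul_eq_mul]
    generalize b.repr x 0 = p
    generalize b.repr x 1 = q
    rw [e0, e1]
    push_cast
    ring

theorem absNorm_span_pair_le (K : Type) [Field K] [NumberField K] {θ : 𝓞 K}
    (hθ : ∀ x : 𝓞 K, ∃ a c : ℤ, x = a + c * θ) {p : ℕ} (hp : p.Prime) (r : ℤ) :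
    Ideal.absNorm (Ideal.span {(p : 𝓞 K), θ - r}) ≤ p := by
  have : NeZero p := ⟨hp.ne_zero⟩
  rw [Ideal.absNorm_apply, Submodule.cardQuot_apply]
  conv_rhs => rw [← Nat.card_zmod p]
  set P := Ideal.span {(p : 𝓞 K), θ - r}
  refine Nat.card_le_card_of_surjective (fun z : ZMod p => Ideal.Quotient.mk P (z.val : 𝓞 K))
    fun y => ?_
  obtain ⟨x, rfl⟩ := Ideal.Quotient.mk_surjective y
  obtain ⟨a, c, rfl⟩ := hθ x
  refine ⟨((a + c * r : ℤ) : ZMod p), Ideal.Quotient.eq.mpr ?_⟩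
  have hz : ((((a + c * r : ℤ) : ZMod p).val : ℤ)) = (a + c * r) % p := ZMod.val_intCast _
  have hz' : ((((a + c * r : ℤ) : ZMod p).val : 𝓞 K)) =
      a + c * r - p * (((a + c * r) / p : ℤ) : 𝓞 K) := by
    have h2 := Int.emod_add_mul_ediv (a + c * r) p
    have h3 := congrArg (Int.cast : ℤ → 𝓞 K) (hz.trans (eq_sub_of_add_eq h2))
    push_cast at h3
    exact_mod_cast h3
  rw [hz', Ideal.mem_span_pair]
  exact ⟨-(((a + c * r) / p : ℤ) : 𝓞 K), -c, by ring⟩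

theorem splitsIn_of_isSquare (K : Type) [Field K] [NumberField K]
    {θ : 𝓞 K} {t n : ℤ} (hθ : θ ^ 2 = t * θ - n) (hspan : ∀ x : 𝓞 K, ∃ a c : ℤ, x = a + c * θ)
    (hdeg : Module.finrank ℚ K = 2)
    {p : ℕ} (hp : p.Prime) (h2 : p ≠ 2) (hpD : ¬ (p : ℤ) ∣ t ^ 2 - 4 * n)
    (hsq : IsSquare ((t ^ 2 - 4 * n : ℤ) : ZMod p)) : SplitsIn p K := by
  have : Fact p.Prime := ⟨hp⟩
  obtain ⟨z, hz⟩ := hsq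
  have h20 : (2 : ZMod p) ≠ 0 := by
    intro h
    have := (ZMod.natCast_eq_zero_iff 2 p).mp (by exact_mod_cast h)
    exact h2 ((Nat.prime_dvd_prime_iff_eq hp Nat.prime_two).mp this)
  obtain ⟨r, hr⟩ := ZMod.intCast_surjective ((t + z) / 2 : ZMod p)
  obtain ⟨s, hs⟩ : ∃ s : ℤ, s = t - r := ⟨_, rfl⟩
  have hs' : (s : ZMod p) = (t - z) / 2 := by
    rw [hs]
    push_cast
    rw [hr]
    field_simp
    ring
  have hz0 : z ≠ 0 := by
    rintro rfl
    exact hpD ((ZMod.intCast_zmod_eq_zero_iff_dvd _ p).mp (by simpa using hz))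
  obtain ⟨k, hk⟩ : (p : ℤ) ∣ r * s - n := by
    rw [← ZMod.intCast_zmod_eq_zero_iff_dvd]
    push_cast at hz ⊢
    rw [hr, hs']
    field_simp
    linear_combination hz
  have hrs : IsCoprime (p : ℤ) (r - s) := by
    rw [(Nat.prime_iff_prime_int.mp hp).irreducible.coprime_iff_not_dvd,
      ← ZMod.intCast_zmod_eq_zero_iff_dvd]
    push_cast
    rw [hr, hs']
    have : ((t : ZMod p) + z) / 2 - (t - z) / 2 = z := by field_simp; ring
    rwa [this]
  obtain ⟨u, v, huv⟩ := hrs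
  have huv' : (u : 𝓞 K) * p + v * (r - s) = 1 := by
    exact_mod_cast congrArg (Int.cast : ℤ → 𝓞 K) huv
  have hk' : (r : 𝓞 K) * s - n = p * k := by exact_mod_cast congrArg (Int.cast : ℤ → 𝓞 K) hk
  have hs'' : (s : 𝓞 K) = t - r := by exact_mod_cast congrArg (Int.cast : ℤ → 𝓞 K) hs
  set P := Ideal.span {(p : 𝓞 K), θ - r} with hP
  set Q := Ideal.span {(p : 𝓞 K), θ - s} with hQ
  have hPQ : Ideal.span {(p : 𝓞 K)} = P * Q := by
    apply le_antisymm
    · rw [Ideal.span_singleton_le_iff_mem]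
      have m1 : (p : 𝓞 K) ∈ P := Ideal.subset_span (by simp)
      have m2 : (p : 𝓞 K) ∈ Q := Ideal.subset_span (by simp)
      have m3 : θ - r ∈ P := Ideal.subset_span (by simp)
      have m4 : θ - s ∈ Q := Ideal.subset_span (by simp)
      have e : (p : 𝓞 K) = u * (p * p) + v * (p * (θ - s) - (θ - r) * p) := by
        linear_combination (-(p : 𝓞 K)) * huv'
      rw [e]
      exact add_mem (Ideal.mul_mem_left _ _ (Ideal.mul_mem_mul m1 m2)) (Ideal.mul_mem_left _ _
        (sub_mem (Ideal.mul_mem_mul m1 m4) (Ideal.mul_mem_mul m3 m2)))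
    · rw [hP, hQ, Ideal.span_pair_mul_span_pair, Ideal.span_le]
      intro x hx
      simp only [Set.mem_insert_iff, Set.mem_singleton_iff] at hx
      rw [SetLike.mem_coe, Ideal.mem_span_singleton]
      rcases hx with rfl | rfl | rfl | rfl
      · exact dvd_mul_right _ _
      · exact dvd_mul_right _ _
      · exact dvd_mul_left _ _
      · refine ⟨k, ?_⟩
        linear_combination hθ + hk' - θ * hs''
  have hnp : Ideal.absNorm (Ideal.span {(p : 𝓞 K)}) = p ^ 2 := by
    rw [Ideal.absNorm_span_natCast, RingOfIntegers.rank, hdeg]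
  have hmul : Ideal.absNorm P * Ideal.absNorm Q = p ^ 2 := by rw [← map_mul, ← hPQ, hnp]
  have hPle : Ideal.absNorm P ≤ p := absNorm_span_pair_le K hspan hp r
  have hQle : Ideal.absNorm Q ≤ p := absNorm_span_pair_le K hspan hp s
  have hPp : Ideal.absNorm P = p := by
    have := hp.pos
    refine le_antisymm hPle ?_
    by_contra! h
    nlinarith [Nat.zero_le (Ideal.absNorm Q)]
  have hQp : Ideal.absNorm Q = p := by
    have := hp.pos
    refine le_antisymm hQle ?_
    by_contra! h
    nlinarith [Nat.zero_le (Ideal.absNorm P)]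
  refine ⟨P, Q, fun h => ?_, Ideal.isPrime_of_irreducible_absNorm (hPp ▸ hp),
    Ideal.isPrime_of_irreducible_absNorm (hQp ▸ hp), hPQ⟩
  have m1 : (p : 𝓞 K) ∈ P := Ideal.subset_span (by simp)
  have m3 : θ - r ∈ P := Ideal.subset_span (by simp)
  have m4 : θ - s ∈ P := h ▸ Ideal.subset_span (by simp)
  have : (1 : 𝓞 K) ∈ P := by
    have e : (1 : 𝓞 K) = u * p + v * ((θ - s) - (θ - r)) := by linear_combination -huv'
    rw [e]
    exact add_mem (Ideal.mul_mem_left _ _ m1) (Ideal.mul_mem_left _ _ (sub_mem m4 m3))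
  rw [← Ideal.eq_top_iff_one] at this
  rw [this, Ideal.absNorm_top] at hPp
  exact hp.one_lt.ne hPp

section

open NumberTheorySymbols

/-- The Jacobi symbol `a ↦ J(a | N)` as a Dirichlet character. -/
noncomputable def jacobiCharacter (N : ℕ) (hN : 1 < N) : DirichletCharacter ℂ N where
  toFun a := (jacobiSym a.val N : ℂ)
  map_one' := by
    have : Fact (1 < N) := ⟨hN⟩
    simp [ZMod.val_one]
  map_mul' a b := by
    rw [← Int.cast_mul, ← jacobiSym.mul_left, ZMod.val_mul]
    congr 1
    push_cast
    exact (jacobiSym.mod_left _ _).symm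
  map_nonunit' a ha := by
    have : NeZero N := ⟨by omega⟩
    rw [Int.cast_eq_zero, jacobiSym.eq_zero_iff_not_coprime]
    contrapose! ha
    rw [← ZMod.natCast_zmod_val a, ZMod.isUnit_iff_coprime]
    exact ha

theorem jacobiCharacter_apply_natCast (N : ℕ) (hN : 1 < N) (a : ℕ) :
    jacobiCharacter N hN a = (jacobiSym a N : ℂ) := by
  change ((jacobiSym (a : ZMod N).val N : ℤ) : ℂ) = _
  rw [ZMod.val_natCast]
  push_cast
  rw [← jacobiSym.mod_left]

/-- The character `a ↦ J(m | a)` on odd `a`, of modulus `4 |m|`. -/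
noncomputable def jacobiCharacterRight (m : ℤ) (hm : m ≠ 0) :
    DirichletCharacter ℂ (4 * m.natAbs) where
  toFun a := if Odd a.val then (jacobiSym m a.val : ℂ) else 0
  map_one' := by
    have : Fact (1 < 4 * m.natAbs) := ⟨by omega⟩
    simp [ZMod.val_one]
  map_mul' a b := by
    have hpar : Odd (a * b).val ↔ Odd a.val ∧ Odd b.val := by
      rw [ZMod.val_mul, ← Nat.odd_mul, Nat.odd_iff, Nat.odd_iff,
        Nat.mod_mod_of_dvd _ ((show 2 ∣ 4 by norm_num).mul_right _)]
    by_cases ha : Odd a.val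
    · by_cases hb : Odd b.val
      · rw [if_pos (hpar.mpr ⟨ha, hb⟩), if_pos ha, if_pos hb, ← Int.cast_mul, ZMod.val_mul,
          ← jacobiSym.mod_right m (ha.mul hb),
          jacobiSym.mul_right' m ha.pos.ne' hb.pos.ne']
      · rw [if_neg (fun h => hb (hpar.mp h).2), if_neg hb, mul_zero]
    · rw [if_neg (fun h => ha (hpar.mp h).1), if_neg ha, zero_mul]
  map_nonunit' a ha := by
    have : NeZero (4 * m.natAbs) := ⟨by omega⟩
    split_ifs with h
    · have : NeZero a.val := ⟨h.pos.ne'⟩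
      rw [Int.cast_eq_zero, jacobiSym.eq_zero_iff_not_coprime]
      contrapose! ha
      rw [← ZMod.natCast_zmod_val a, ZMod.isUnit_iff_coprime]
      have h2 : Nat.Coprime a.val 2 := Nat.coprime_two_right.mpr h
      have h3 : Nat.Coprime a.val m.natAbs := by
        rw [Nat.coprime_comm]
        exact ha
      exact Nat.Coprime.mul_right (Nat.Coprime.pow_right 2 h2) h3
    · rfl

theorem jacobiCharacterRight_apply_natCast (m : ℤ) (hm : m ≠ 0) {a : ℕ} (ha : Odd a) :
    jacobiCharacterRight m hm a = (jacobiSym m a : ℂ) := by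
  change (if Odd (a : ZMod (4 * m.natAbs)).val then (jacobiSym m (a : ZMod (4 * m.natAbs)).val : ℂ)
    else 0) = _
  rw [ZMod.val_natCast, ← jacobiSym.mod_right m ha, if_pos]
  rw [Nat.odd_iff, Nat.mod_mod_of_dvd _ ((show 2 ∣ 4 by norm_num).mul_right _)]
  exact Nat.odd_iff.mp ha

theorem jacobiSym_natAbs_of_one_mod_four {D : ℤ} (hD : D % 4 = 1) {p : ℕ} (hp : Odd p) :
    jacobiSym p D.natAbs = jacobiSym D p := by
  rcases Int.natAbs_eq D with h | h
  · rw [← jacobiSym.quadratic_reciprocity_one_mod_four (by omega) hp, ← h]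
  · have h3 : D.natAbs % 4 = 3 := by omega
    have e : jacobiSym D p = ZMod.χ₄ p * jacobiSym D.natAbs p := by
      rw [← jacobiSym.neg _ hp, ← h]
    rw [e]
    rcases Nat.odd_mod_four_iff.mp (Nat.odd_iff.mp hp) with h1 | h1
    · rw [ZMod.χ₄_nat_one_mod_four h1, one_mul,
        jacobiSym.quadratic_reciprocity_one_mod_four h1 (Nat.odd_iff.mpr (by omega))]
    · rw [ZMod.χ₄_nat_three_mod_four h1, jacobiSym.quadratic_reciprocity_three_mod_four h1 h3]
      ring

theorem exists_quadratic_character {D : ℤ} (hD : D % 4 = 0 ∨ D % 4 = 1) (h1 : 1 < D.natAbs) :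
    ∃ χ : DirichletCharacter ℂ D.natAbs, (∀ a, χ a = 0 ∨ χ a = 1 ∨ χ a = -1) ∧
      ∀ p : ℕ, Odd p → χ p = (jacobiSym D p : ℂ) := by
  rcases hD with hD | hD
  · obtain ⟨m, rfl⟩ := Int.dvd_of_emod_eq_zero hD
    have hm : m ≠ 0 := by rintro rfl; simp at h1
    have e : (4 * m).natAbs = 4 * m.natAbs := by omega
    rw [e]
    refine ⟨jacobiCharacterRight m hm, fun a => ?_, fun p hp => ?_⟩
    · change (if Odd a.val then (jacobiSym m a.val : ℂ) else 0) = 0 ∨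
        (if Odd a.val then (jacobiSym m a.val : ℂ) else 0) = 1 ∨
        (if Odd a.val then (jacobiSym m a.val : ℂ) else 0) = -1
      split_ifs
      · exact_mod_cast jacobiSym.trichotomy m a.val
      · exact Or.inl rfl
    · rw [jacobiCharacterRight_apply_natCast m hm hp, jacobiSym.mul_left, jacobiSym.at_four hp,
        one_mul]
  · refine ⟨jacobiCharacter D.natAbs h1, fun a => ?_, fun p hp => ?_⟩
    · change (jacobiSym a.val D.natAbs : ℂ) = 0 ∨ (jacobiSym a.val D.natAbs : ℂ) = 1 ∨
        (jacobiSym a.val D.natAbs : ℂ) = -1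
      exact_mod_cast jacobiSym.trichotomy a.val D.natAbs
    · rw [jacobiCharacter_apply_natCast, jacobiSym_natAbs_of_one_mod_four hD hp]

theorem primitiveCharacter_sq_of_real {N : ℕ} [NeZero N] {χ : DirichletCharacter ℂ N}
    (hχ : ∀ a, χ a = 0 ∨ χ a = 1 ∨ χ a = -1) (a : ZMod χ.conductor) :
    χ.primitiveCharacter a = 0 ∨ χ.primitiveCharacter a = 1 ∨ χ.primitiveCharacter a = -1 := by
  have hsq : χ ^ 2 = 1 := by
    ext u
    rw [MulChar.pow_apply_coe, MulChar.one_apply_coe]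
    have := (u.isUnit.map χ).ne_zero
    rcases hχ u with h | h | h <;> simp_all
  have hsq' : χ.primitiveCharacter ^ 2 = 1 := by
    apply DirichletCharacter.changeLevel_injective χ.conductor_dvd_level
    rw [map_pow, DirichletCharacter.changeLevel_primitiveCharacter, hsq, map_one]
  by_cases ha : IsUnit a
  · right
    obtain ⟨u, rfl⟩ := ha
    have := MulChar.pow_apply_coe χ.primitiveCharacter 2 u
    rw [hsq', MulChar.one_apply_coe] at this
    exact mul_self_eq_one_iff.mp (by rw [← pow_two, ← this])
  · exact Or.inl (χ.primitiveCharacter.map_nonunit ha)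

end

section

open Finset Chebyshev Real
open ArithmeticFunction hiding log

theorem log_le_mul_of_pos {z : ℝ} (hz : 0 < z) : log z ≤ 0.368 * z := by
  have h := log_le_sub_one_of_pos (div_pos hz (exp_pos 1))
  rw [log_div hz.ne' (exp_pos 1).ne', log_exp] at h
  have he : z / exp 1 ≤ 0.368 * z := by
    rw [div_le_iff₀ (exp_pos 1)]
    nlinarith [exp_one_gt_d9]
  linarith

theorem exp_two_gt : (7.38 : ℝ) < exp 2 := by
  have : exp 2 = exp 1 * exp 1 := by rw [← exp_add]; norm_num
  nlinarith [exp_one_gt_d9]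

theorem log_le_add_one {z : ℝ} (hz : 0 < z) : log z ≤ 0.1356 * z + 1 := by
  have h := log_le_sub_one_of_pos (div_pos hz (exp_pos 2))
  rw [log_div hz.ne' (exp_pos 2).ne', log_exp] at h
  have : z / exp 2 ≤ 0.1356 * z := by
    rw [div_le_iff₀ (exp_pos 2)]
    nlinarith [exp_two_gt]
  linarith

theorem log_four_lt : log 4 < 1.3863 := by
  have : log 4 = 2 * log 2 := by
    rw [show (4 : ℝ) = 2 ^ 2 by norm_num, log_pow]
    norm_num
  linarith [log_two_lt_d9]

theorem psi_sq_le {v : ℝ} (hv : 1 ≤ v) : psi (v ^ 2) ≤ 1.3863 * v ^ 2 + 4 * v * log v := by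
  have h := psi_le (show 1 ≤ v ^ 2 by nlinarith)
  rw [sqrt_sq (by linarith), log_pow] at h
  push_cast at h
  nlinarith [log_four_lt, sq_nonneg v]

theorem psi_sub_theta_sq_le {y : ℝ} (hy : 53 ≤ y) : psi (y ^ 2) - theta (y ^ 2) ≤ 3.65 * y := by
  have hy0 : 0 ≤ y := by linarith
  have key : ∀ k : ℝ, (y ^ 2) ^ k = (y ^ k) ^ 2 := fun k => by
    rw [← rpow_natCast, ← rpow_natCast, ← rpow_mul hy0, ← rpow_mul hy0, mul_comm]
  have root : ∀ k : ℕ, k ≠ 0 → (y ^ ((k : ℝ)⁻¹)) ^ k = y := fun k hk =>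
    rpow_inv_natCast_pow hy0 hk
  have lower : ∀ (k : ℕ) (c : ℝ), k ≠ 0 → 0 ≤ c → c ^ k ≤ 53 → c ≤ y ^ ((k : ℝ)⁻¹) := by
    intro k c hk hc h
    refine le_of_pow_le_pow_left₀ hk (rpow_nonneg hy0 _) ?_
    rw [root k hk]
    linarith
  have h := psi_sub_theta_le_psi_add_psi_add_psi (y ^ 2)
  rw [key, key, key] at h
  have v0 := lower 2 7.28 (by norm_num) (by norm_num) (by norm_num)
  have w0 := lower 3 3.75 (by norm_num) (by norm_num) (by norm_num)
  have u0 := lower 5 2.2 (by norm_num) (by norm_num) (by norm_num)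
  have v1 := root 2 (by norm_num)
  have w1 := root 3 (by norm_num)
  have u1 := root 5 (by norm_num)
  push_cast at v0 w0 u0 v1 w1 u1
  set v := y ^ (2 : ℝ)⁻¹
  set w := y ^ (3 : ℝ)⁻¹
  set u := y ^ (5 : ℝ)⁻¹
  have hv := psi_sq_le (show 1 ≤ v by linarith)
  have hw := psi_sq_le (show 1 ≤ w by linarith)
  have hu := psi_sq_le (show 1 ≤ u by linarith)
  have lv : log v ≤ 0.3 * v := by
    have := log_le_add_one (show 0 < v by linarith)
    linarith
  have lw := log_le_mul_of_pos (show 0 < w by linarith)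
  have lu := log_le_mul_of_pos (show 0 < u by linarith)
  have hv' : psi (v ^ 2) ≤ 2.5863 * y := by
    rw [← v1] at *
    nlinarith
  have hw' : psi (w ^ 2) ≤ 0.763 * y := by
    have a : psi (w ^ 2) ≤ 2.8583 * w ^ 2 := by nlinarith
    have b : 3.75 * w ^ 2 ≤ y := by
      rw [← w1, pow_succ w 2, mul_comm]
      exact mul_le_mul_of_nonneg_left w0 (sq_nonneg w)
    linarith
  have hu' : psi (u ^ 2) ≤ 0.269 * y := by
    have a : psi (u ^ 2) ≤ 2.8583 * u ^ 2 := by nlinarith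
    have b : 10.648 * u ^ 2 ≤ y := by
      have c : (10.648 : ℝ) ≤ u ^ 3 := by
        have := pow_le_pow_left₀ (by norm_num) u0 3
        norm_num at this ⊢
        exact this
      calc 10.648 * u ^ 2 ≤ u ^ 3 * u ^ 2 := mul_le_mul_of_nonneg_right c (sq_nonneg u)
        _ = u ^ 5 := by ring
        _ = y := u1
    linarith
  linarith

theorem sum_primeFactors_log_le {m : ℕ} (hm : m ≠ 0) : ∑ p ∈ m.primeFactors, log p ≤ log m := by
  rw [← log_prod (fun p hp => by
    exact_mod_cast (Nat.prime_of_mem_primeFactors hp).ne_zero), ← Nat.cast_prod]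
  have h := Nat.le_of_dvd (Nat.pos_of_ne_zero hm) (Nat.prod_primeFactors_dvd m)
  refine log_le_log ?_ (by exact_mod_cast h)
  exact_mod_cast Finset.prod_pos fun p hp => (Nat.prime_of_mem_primeFactors hp).pos

theorem sum_filter_log_le {m : ℕ} (hm : m ≠ 0) (s : Finset ℕ) :
    ∑ n ∈ s, (if n ∈ m.primeFactors then log n else 0) ≤ log m := by
  rw [← Finset.sum_filter]
  refine (Finset.sum_le_sum_of_subset_of_nonneg (fun n hn => (Finset.mem_filter.mp hn).2)
    fun n _ _ => log_natCast_nonneg n).trans (sum_primeFactors_log_le hm)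

theorem sum_vonMangoldt_mul_le {x : ℝ} {m : ℕ} (hm : m ≠ 0) {c : ℕ → ℝ} (hc : ∀ n, |c n| ≤ 1)
    (h : ∀ p : ℕ, p.Prime → (p : ℝ) ≤ x → ¬ p ∣ m → c p = -1) (hx : 0 ≤ x) :
    ∑ n ∈ range (⌊x⌋₊ + 1), Λ n * (1 + c n) ≤ 2 * (psi x - theta x) + 2 * log m := by
  have hterm : ∀ n ∈ range (⌊x⌋₊ + 1), Λ n * (1 + c n) ≤
      2 * (if ¬ n.Prime then Λ n else 0) + 2 * (if n ∈ m.primeFactors then log n else 0) := by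
    intro n hn
    have hc' := (abs_le.mp (hc n)).2
    have hΛ := vonMangoldt_nonneg (n := n)
    by_cases hp : n.Prime
    · rw [if_neg (not_not.mpr hp)]
      by_cases hd : n ∣ m
      · rw [if_pos (Nat.mem_primeFactors.mpr ⟨hp, hd, hm⟩), vonMangoldt_apply_prime hp]
        rw [vonMangoldt_apply_prime hp] at hΛ
        nlinarith
      · have hnx : (n : ℝ) ≤ x :=
          (Nat.le_floor_iff hx).mp (Nat.lt_succ_iff.mp (Finset.mem_range.mp hn))
        rw [h n hp hnx hd, if_neg (fun h => hd (Nat.dvd_of_mem_primeFactors h))]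
        simp
    · rw [if_pos hp, if_neg (fun h => hp (Nat.prime_of_mem_primeFactors h))]
      nlinarith
  refine (Finset.sum_le_sum hterm).trans ?_
  rw [Finset.sum_add_distrib, ← Finset.mul_sum, ← Finset.mul_sum]
  have h1 := sum_filter_log_le hm (range (⌊x⌋₊ + 1))
  have h2 : ∑ n ∈ range (⌊x⌋₊ + 1), (if ¬ n.Prime then Λ n else 0) = psi x - theta x := by
    rw [psi_sub_theta_eq_sum_not_prime, Finset.sum_filter]
    symm
    refine Finset.sum_subset (fun n hn => ?_) (fun n hn hn' => ?_)
    · rw [Finset.mem_Ioc] at hn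
      exact Finset.mem_range.mpr (by omega)
    · rw [Finset.mem_range] at hn
      rw [Finset.mem_Ioc] at hn'
      have : n = 0 := by omega
      simp [this]
  rw [h2]
  linarith

theorem exists_prime_not_dvd {y l : ℝ} {m : ℕ} (hm : m ≠ 0) (hy : 53 ≤ y) (hl : l ≤ y)
    (hml : log m ≤ l + 1) : ∃ p : ℕ, p.Prime ∧ (p : ℝ) ≤ y ^ 2 ∧ ¬ p ∣ m := by
  by_contra! h
  have h1 : theta (y ^ 2) ≤ log m := by
    rw [theta]
    refine (Finset.sum_le_sum_of_subset_of_nonneg (fun n hn => ?_)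
      fun n _ _ => log_natCast_nonneg n).trans (sum_primeFactors_log_le hm)
    rw [Finset.mem_filter, Finset.mem_Ioc] at hn
    exact Nat.mem_primeFactors.mpr
      ⟨hn.2, h n hn.2 ((Nat.le_floor_iff (sq_nonneg y)).mp hn.1.2), hm⟩
  have h2 := psi_sub_theta_sq_le hy
  have h3 := psi_ge' (sq_nonneg y)
  have h4 := log_le_mul_of_pos (show 0 < y ^ 2 + 2 by positivity)
  have h5 := mul_le_mul_of_nonneg_left log_two_gt_d9.le (show 0 ≤ y ^ 2 - 1 by nlinarith)
  nlinarith

theorem rampExp_sub_log_div_sqrt_le (L : ℝ) {n : ℕ} (hn : 0 < n) :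
    rampExp (L - log n) / √n ≤ 0.736 * exp (-L / 2) := by
  have hn' : (0 : ℝ) < n := by exact_mod_cast hn
  rcases le_total (L - log n) 0 with h | h
  · rw [rampExp_of_nonpos h, zero_div]
    positivity
  rw [rampExp_of_nonneg h]
  obtain ⟨u, hu⟩ : ∃ u, u = L - log n := ⟨_, rfl⟩
  have e : √n = exp (L / 2) * exp (-u / 2) := by
    rw [← exp_add, sqrt_eq_rpow, rpow_def_of_pos hn']
    congr 1
    rw [hu]
    ring
  rw [← hu] at h ⊢
  have e2 : u * exp (-u) / √n = u * exp (-u / 2) * exp (-L / 2) := by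
    rw [e, div_eq_iff (by positivity)]
    have a1 : exp (-u) = exp (-u / 2) * exp (-u / 2) := by rw [← exp_add]; ring_nf
    have a2 : exp (-L / 2) * exp (L / 2) = 1 := by rw [← exp_add]; ring_nf; simp
    rw [a1]
    linear_combination (-u * exp (-u / 2) * exp (-u / 2)) * a2
  rw [e2]
  refine mul_le_mul_of_nonneg_right ?_ (exp_pos _).le
  rcases h.eq_or_lt with h0 | h0
  · rw [← h0]
    norm_num
  have h3 : u ≤ 0.736 * exp (u / 2) := by
    have := log_le_mul_of_pos (exp_pos (u / 2))
    rw [log_exp] at this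
    linarith
  have a3 : exp (u / 2) * exp (-u / 2) = 1 := by rw [← exp_add]; ring_nf; simp
  nlinarith [exp_pos (-u / 2)]

theorem dirichletOriginal_vonMangoldt_le {c : ℕ → ℝ} (hc : ∀ n, |c n| ≤ 1) (L : ℝ) :
    dirichletOriginal (fun n => Λ n * (1 + c n) / √n) L ≤
      0.736 * exp (-L / 2) * ∑ n ∈ range (⌊exp L⌋₊ + 1), Λ n * (1 + c n) := by
  rw [dirichletOriginal_eq_sum (N := ⌊exp L⌋₊ + 1) (by simp)
    (by push_cast; exact (Nat.lt_floor_add_one _).le), Finset.mul_sum]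
  refine Finset.sum_le_sum fun n _ => ?_
  rcases Nat.eq_zero_or_pos n with rfl | hn
  · simp
  have h1 := (abs_le.mp (hc n)).1
  have h2 := mul_nonneg (vonMangoldt_nonneg (n := n)) (show 0 ≤ 1 + c n by linarith)
  have h3 := mul_le_mul_of_nonneg_left (rampExp_sub_log_div_sqrt_le L hn) h2
  calc _ = Λ n * (1 + c n) * (rampExp (L - log n) / √n) := by ring
    _ ≤ _ := h3
    _ = _ := by ring

end

section

open Real

theorem one_lt_log_pi : 1.0986 < log π :=
  lt_trans (by linarith [log_three_gt_d9]) (log_lt_log (by norm_num) pi_gt_three)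

theorem log_pi_lt : log π < 1.3863 :=
  (log_lt_log pi_pos pi_lt_four).trans log_four_lt

theorem rdigamma_quarter_ge : -4.4337 ≤ rdigamma (1 / 4) := by
  have h1 := rdigamma_add_one (show (0 : ℝ) < 1 / 4 by norm_num)
  have h2 := rdigamma_add_one (show (0 : ℝ) < 1 / 4 + 1 by norm_num)
  have h3 := log_le_rdigamma_add_one (show (0 : ℝ) < 9 / 4 by norm_num)
  have h4 := rdigamma_add_one (show (0 : ℝ) < 9 / 4 by norm_num)
  have h5 : log (9 / 4) = 2 * log 3 - 2 * log 2 := by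
    rw [show (9 / 4 : ℝ) = (3 / 2) ^ 2 by norm_num, log_pow,
      log_div (by norm_num) (by norm_num)]
    push_cast
    ring
  norm_num at h1 h2 h3 h4
  linarith [log_three_gt_d9, log_two_lt_d9]

theorem rdigamma_quarter_le : rdigamma (1 / 4) ≤ -3.75 := by
  have h1 := rdigamma_add_one (show (0 : ℝ) < 1 / 4 by norm_num)
  have h2 := rdigamma_le_log (show (0 : ℝ) < 1 / 4 + 1 by norm_num)
  have h3 := log_le_sub_one_of_pos (show (0 : ℝ) < 1 / 4 + 1 by norm_num)
  norm_num at h1 h2 h3 ⊢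
  linarith

theorem rdigamma_three_quarters_le : rdigamma (3 / 4) ≤ -0.806 := by
  have h1 := rdigamma_add_one (show (0 : ℝ) < 3 / 4 by norm_num)
  have h2 := rdigamma_add_one (show (0 : ℝ) < 3 / 4 + 1 by norm_num)
  have h3 := rdigamma_le_log (show (0 : ℝ) < 11 / 4 by norm_num)
  have h4 := log_lt_log (show (0 : ℝ) < 11 / 4 by norm_num) (show (11 / 4 : ℝ) < 3 by norm_num)
  norm_num at h1 h2 h3 h4
  linarith [log_three_lt_d9]

theorem rdigamma_quarter_le_three_quarters : rdigamma (1 / 4) ≤ rdigamma (3 / 4) :=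
  rdigamma_monotoneOn (by norm_num) (by norm_num) (by norm_num)

theorem gammaConst_le {δ : ℝ} (hδ : δ = 0 ∨ δ = 1) : gammaConst δ ≤ 4.4337 := by
  have h1 := rdigamma_quarter_ge
  have h2 := rdigamma_quarter_le_three_quarters
  rcases hδ with rfl | rfl <;> rw [gammaConst] <;> norm_num at h1 h2 ⊢ <;> linarith

theorem archimedean_const_le {δ : ℝ} (hδ : δ = 0 ∨ δ = 1) :
    8 / 3 - log π + gammaConst δ + rdigamma (3 / 4) + rdigamma ((3 / 2 + δ) / 2) ≤ 4.4 := by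
  have h1 := rdigamma_quarter_ge
  have h2 := rdigamma_quarter_le
  have h3 := rdigamma_three_quarters_le
  have h4 := one_lt_log_pi
  have h5 := rdigamma_add_one (show (0 : ℝ) < 1 / 4 by norm_num)
  rcases hδ with rfl | rfl <;> rw [gammaConst] <;> norm_num at h1 h2 h3 h4 h5 ⊢ <;> linarith

theorem explicit_bound_lt {y l F S δ : ℝ} (hl : 25 ≤ l) (hy : y = 1.881 * l + 6.18)
    (hF0 : 0 ≤ F) (hF : F ≤ l) (hδ : δ = 0 ∨ δ = 1)
    (hS : S ≤ 0.736 * y⁻¹ * (2 * (3.65 * y) + 2 * (l + 1))) :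
    (8 / 3 + F / 2 - log π + gammaConst δ + rdigamma (3 / 4) + rdigamma ((3 / 2 + δ) / 2)) *
        (1 + (1 + 2 * log y) * exp (-(2 * log y))) <
      poleOriginal (1 / 2) (2 * log y) + poleOriginal (-1 / 2) (2 * log y) +
        (F / 2 - log π - gammaConst δ) * (2 * log y * exp (-(2 * log y))) - S := by
  have hy53 : 53 ≤ y := by linarith
  have hy0 : 0 < y := by linarith
  have e1 : exp (-(2 * log y)) = y⁻¹ ^ 2 := by
    rw [exp_neg, two_mul, exp_add, exp_log hy0, inv_pow, sq]
  have e2 : exp (1 / 2 * (2 * log y)) = y := by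
    rw [show 1 / 2 * (2 * log y) = log y by ring, exp_log hy0]
  have e3 : exp (-1 / 2 * (2 * log y)) = y⁻¹ := by
    rw [show -1 / 2 * (2 * log y) = -log y by ring, exp_neg, exp_log hy0]
  have g0 : 0 ≤ log y := log_nonneg (by linarith)
  have g1 := log_le_add_one hy0
  have i0 : 0 < y⁻¹ := inv_pos.mpr hy0
  have i1 : y⁻¹ * y = 1 := inv_mul_cancel₀ hy0.ne'
  have i2 : y⁻¹ ≤ 0.0189 := by
    rw [inv_le_comm₀ hy0 (by norm_num)]
    norm_num
    linarith
  have i3 : y⁻¹ * log y ≤ 0.1545 := by nlinarith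
  have q0 : 0 ≤ y⁻¹ ^ 2 * log y := by positivity
  have q1 : y⁻¹ ^ 2 * log y ≤ 0.00293 := by nlinarith
  have q2 : y⁻¹ ^ 2 ≤ 0.00036 := by nlinarith
  have c1 := archimedean_const_le hδ
  have c2 := gammaConst_le hδ
  have c3 := log_pi_lt
  have hS' : S ≤ 6.2 := by
    have : y⁻¹ * (l + 1) ≤ 0.54 := by
      have : l + 1 ≤ 0.54 * y := by linarith
      nlinarith
    nlinarith
  rw [poleOriginal, poleOriginal, e1, e2, e3]
  have p2 : 0 ≤ (y⁻¹ - y⁻¹ ^ 2 * (1 + (1 + -1 / 2) * (2 * log y))) / (1 + -1 / 2) ^ 2 := by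
    apply div_nonneg _ (by norm_num)
    nlinarith
  have p1 : 4 / 9 * y - 0.005 ≤
      (y - y⁻¹ ^ 2 * (1 + (1 + 1 / 2) * (2 * log y))) / (1 + 1 / 2) ^ 2 := by
    rw [le_div_iff₀ (by norm_num)]
    nlinarith
  have k : -0.04 ≤ (F / 2 - log π - gammaConst δ) * (2 * log y * y⁻¹ ^ 2) := by
    nlinarith
  have r : (8 / 3 + F / 2 - log π + gammaConst δ + rdigamma (3 / 4) +
      rdigamma ((3 / 2 + δ) / 2)) * (1 + (1 + 2 * log y) * y⁻¹ ^ 2) ≤ (l / 2 + 4.4) * 1.0063 := by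
    refine mul_le_mul (by linarith) (by nlinarith) (by nlinarith) (by linarith)
  linarith

end

section
open Real NumberTheorySymbols

theorem isSquare_of_jacobiSym_eq_one {D : ℤ} {p : ℕ} (hp : p.Prime) (h : jacobiSym D p = 1) :
    IsSquare (D : ZMod p) := by
  have := Fact.mk hp
  exact ZMod.isSquare_of_jacobiSym_eq_one h

theorem jacobiSym_ne_zero_of_prime {D : ℤ} {p : ℕ} (hp : p.Prime) (h : ¬ p ∣ D.natAbs) :
    jacobiSym D p ≠ 0 := by
  apply jacobiSym.ne_zero
  rw [Int.gcd_comm]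
  exact (Nat.Prime.coprime_iff_not_dvd hp).mpr h

theorem exists_prime_jacobiSym_eq_one (herh : ERH) {D : ℤ} (hD4 : D % 4 = 0 ∨ D % 4 = 1)
    (hD : exp 25 < |(D : ℝ)|) :
    ∃ p : ℕ, p.Prime ∧ p ≠ 2 ∧ ¬ p ∣ D.natAbs ∧ jacobiSym D p = 1 ∧
      (p : ℝ) ≤ (1.881 * log |(D : ℝ)| + 6.18) ^ 2 := by
  have habs : |(D : ℝ)| = (D.natAbs : ℝ) := by
    rw [Nat.cast_natAbs, Int.cast_abs]
  rw [habs] at hD ⊢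
  have hexp : (26 : ℝ) ≤ exp 25 := by linarith [add_one_le_exp (25 : ℝ)]
  have h1 : 1 < D.natAbs := by
    have : (1 : ℝ) < D.natAbs := by linarith
    exact_mod_cast this
  have hex := exists_quadratic_character hD4 h1
  clear habs
  generalize hN : D.natAbs = N at hD h1 hex ⊢
  obtain ⟨χ, hχ, hχJ⟩ := hex
  have hN0 : (0 : ℝ) < N := by linarith
  have : NeZero N := ⟨by omega⟩
  set l := log N with hl
  have hl25 : 25 ≤ l := by
    rw [hl, le_log_iff_exp_le hN0]
    exact hD.le
  set y := 1.881 * l + 6.18 with hy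
  have hy0 : 0 < y := by linarith
  have hm : 2 * N ≠ 0 := by omega
  have hml : log ((2 * N : ℕ) : ℝ) ≤ l + 1 := by
    push_cast
    rw [log_mul (by norm_num) hN0.ne']
    linarith [log_two_lt_d9]
  have hodd : ∀ p : ℕ, p.Prime → ¬ p ∣ 2 * N → p ≠ 2 ∧ ¬ p ∣ N ∧ Odd p := by
    intro p hp hd
    have h2 : p ≠ 2 := fun h => hd (h ▸ dvd_mul_right 2 N)
    exact ⟨h2, fun h => hd (h.mul_left 2), hp.odd_of_ne_two h2⟩
  by_cases hχ1 : χ = 1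
  · obtain ⟨p, hp, hpy, hd⟩ := exists_prime_not_dvd (y := y) (l := l) hm (by linarith) (by linarith) hml
    obtain ⟨h2, hpN, hpo⟩ := hodd p hp hd
    refine ⟨p, hp, h2, hpN, ?_, hpy⟩
    have h := hχJ p hpo
    rw [hχ1, MulChar.one_apply
      ((ZMod.isUnit_iff_coprime p N).mpr ((Nat.Prime.coprime_iff_not_dvd hp).mpr hpN))] at h
    exact_mod_cast h.symm
  · by_contra! hno
    set f := χ.conductor with hf
    have hfN : f ∣ N := χ.conductor_dvd_level
    have : NeZero f := ⟨fun h => NeZero.ne N (by rwa [h, zero_dvd_iff] at hfN)⟩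
    set ψ := χ.primitiveCharacter with hψ
    have hψ1 : ψ ≠ 1 := by
      intro h
      apply hχ1
      rw [← χ.changeLevel_primitiveCharacter, ← hψ, h, map_one]
    have hval : ∀ a, ψ a = 0 ∨ ψ a = 1 ∨ ψ a = -1 := primitiveCharacter_sq_of_real hχ
    have hreal : ∀ a, (starRingEnd ℂ) (ψ a) = ψ a := by
      intro a
      rcases hval a with h | h | h <;> simp [h]
    have hc : ∀ n : ℕ, |(ψ n).re| ≤ 1 := by
      intro n
      rcases hval n with h | h | h <;> simp [h]
    have hneg : ∀ p : ℕ, p.Prime → (p : ℝ) ≤ y ^ 2 → ¬ p ∣ 2 * N → (ψ p).re = -1 := by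
      intro p hp hpy hd
      obtain ⟨h2, hpN, hpo⟩ := hodd p hp hd
      have hcop : IsCoprime (p : ℤ) (N : ℤ) :=
        Nat.isCoprime_iff_coprime.mpr ((Nat.Prime.coprime_iff_not_dvd hp).mpr hpN)
      have h := χ.primitiveCharacter_apply_of_isCoprime hcop
      push_cast at h
      rw [← hψ, hχJ p hpo] at h
      have hJ : jacobiSym D p = -1 := by
        rcases jacobiSym.trichotomy D p with h0 | h0 | h0
        · exact absurd h0 (jacobiSym_ne_zero_of_prime hp (hN ▸ hpN))
        · exact absurd hpy (not_le.mpr (hno p hp h2 hpN h0))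
        · exact h0
      rw [h, hJ]
      simp
    have hL : 0 < 2 * log y := by
      have := log_pos (show 1 < y by linarith)
      linarith
    have hexpL : exp (2 * log y) = y ^ 2 := by
      rw [two_mul, exp_add, exp_log hy0, sq]
    have hexpL' : exp (-(2 * log y) / 2) = y⁻¹ := by
      rw [show -(2 * log y) / 2 = -log y by ring, exp_neg, exp_log hy0]
    have hS := dirichletOriginal_vonMangoldt_le hc (2 * log y)
    have hsum := sum_vonMangoldt_mul_le hm hc hneg (sq_nonneg y)
    have hpsi := psi_sub_theta_sq_le (show 53 ≤ y by linarith)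
    rw [hexpL, hexpL'] at hS
    have hf1 : (1 : ℝ) ≤ f := by exact_mod_cast Nat.one_le_iff_ne_zero.mpr (NeZero.ne f)
    have hfl : log f ≤ l :=
      log_le_log (by linarith) (by exact_mod_cast Nat.le_of_dvd (by omega) hfN)
    have hδ : parity ψ = 0 ∨ parity ψ = 1 := parity_eq_zero_or_one ψ
    have hlt := explicit_bound_lt hl25 hy (log_nonneg hf1) hfl hδ
      (hS.trans (mul_le_mul_of_nonneg_left (hsum.trans (by linarith)) (by positivity)))
    have hle := explicit_le_of_ERH herh hψ1 χ.primitiveCharacter_isPrimitive hreal hL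
    linarith

end

/-- (Bach) Assume ERH. If `K` is a quadratic number field with `|disc K| > e^25`, then there is
a split prime `p ≤ (1.881 log|D| + 2·0.34 + 5.5)^2`. -/
theorem exists_small_split_prime_of_ERH (herh : ERH)
    (K : Type) [Field K] [NumberField K] (hdeg : Module.finrank ℚ K = 2)
    (hD : Real.exp 25 < |(NumberField.discr K : ℝ)|) :
    ∃ p : ℕ, p.Prime ∧ SplitsIn p K ∧
      (p : ℝ) ≤ (1.881 * Real.log |(NumberField.discr K : ℝ)| + 2 * 0.34 + 5.5) ^ 2 := by
  obtain ⟨θ, t, n, hθ, hdisc, hspan⟩ := exists_theta K hdeg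
  have hD4 : NumberField.discr K % 4 = 0 ∨ NumberField.discr K % 4 = 1 := by
    rw [hdisc]
    rcases Int.even_or_odd' t with ⟨k, rfl | rfl⟩
    · left
      ring_nf
      omega
    · right
      ring_nf
      omega
  obtain ⟨p, hp, h2, hpD, hJ, hle⟩ := exists_prime_jacobiSym_eq_one herh hD4 hD
  refine ⟨p, hp, ?_, ?_⟩
  · rw [hdisc] at hpD hJ
    refine splitsIn_of_isSquare K hθ hspan hdeg hp h2 ?_ (isSquare_of_jacobiSym_eq_one hp hJ)
    rwa [Int.natCast_dvd]
  · norm_num at hle ⊢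
    convert hle using 2
    ring
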